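/- arXiv:2305.08368 — 5 statements merged into one kernel-verified Lean document; each statement's English description precedes it below -/
import Mathlib

section
/- Let m ≥ 1, let σ > 0, let 0 < a < b, and let ω ∈ ℝ^m be such that there exist constants c₁ > 0 and τ ≥ 0 with σ > m + τ and |⟨k,ω⟩| ≥ c₁/|k|^τ for every k ∈ ℤ^m \ {0}. Then there exists c₀ > 0 such that the set of γ₀ ∈ [a, b] for which (ω, γ₀) satisfies the Diophantine condition DC(c₀, σ) has positive Lebesgue measure. -/
open scoped BigOperators
open MeasureTheory

lemma bad_one (a b α ε : ℝ) (hab : a < b) (hα : 0 < α) (hε : 0 < ε) :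
    volume {γ : ℝ | γ ∈ Set.Icc a b ∧ ∃ j : ℤ, |α * γ - j| < ε} ≤
      ENNReal.ofReal (2 * ε / α * (α * (b - a) + 2 * ε + 1)) := by
  set F := Finset.Icc ⌈α * a - ε⌉ ⌊α * b + ε⌋ with hF
  have hsub : {γ : ℝ | γ ∈ Set.Icc a b ∧ ∃ j : ℤ, |α * γ - j| < ε} ⊆
      ⋃ j ∈ F, Metric.ball ((j : ℝ) / α) (ε / α) := by
    rintro γ ⟨⟨h1, h2⟩, j, hj⟩
    simp only [Set.mem_iUnion]
    have h3 := abs_lt.1 hj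
    have h4 := mul_le_mul_of_nonneg_left h1 hα.le
    have h5 := mul_le_mul_of_nonneg_left h2 hα.le
    refine ⟨j, ?_, ?_⟩
    · rw [hF, Finset.mem_Icc, Int.ceil_le, Int.le_floor]
      constructor <;> linarith [h3.1, h3.2]
    · rw [Metric.mem_ball, Real.dist_eq, lt_div_iff₀ hα]
      have h6 : α * γ - j = (γ - j / α) * α := by field_simp
      rwa [h6, abs_mul, abs_of_pos hα] at hj
  have hcard : (F.card : ℝ) ≤ α * (b - a) + 2 * ε + 1 := by
    have hpos : 0 < α * (b - a) := mul_pos hα (by linarith)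
    rw [hF, Int.card_Icc]
    have h1 := Int.le_ceil (α * a - ε)
    have h2 := Int.floor_le (α * b + ε)
    have : (((⌊α * b + ε⌋ + 1 - ⌈α * a - ε⌉).toNat : ℤ) : ℝ) ≤ α * (b - a) + 2 * ε + 1 := by
      rw [Int.toNat_eq_max]
      push_cast
      apply max_le <;> linarith
    exact_mod_cast this
  calc _ ≤ volume (⋃ j ∈ F, Metric.ball ((j : ℝ) / α) (ε / α)) := measure_mono hsub
    _ ≤ ∑ j ∈ F, volume (Metric.ball ((j : ℝ) / α) (ε / α)) := measure_biUnion_finset_le _ _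
    _ = ENNReal.ofReal (F.card * (2 * (ε / α))) := by
      simp only [Real.volume_ball, Finset.sum_const, nsmul_eq_mul]
      rw [ENNReal.ofReal_mul (by positivity)]; simp
    _ ≤ _ := by
      apply ENNReal.ofReal_le_ofReal
      have : 0 ≤ 2 * (ε / α) := by positivity
      calc _ ≤ (α * (b - a) + 2 * ε + 1) * (2 * (ε / α)) := by gcongr
        _ = _ := by ring

lemma summable_lattice_aux (m : ℕ) (r : ℝ) (hr : r < -(m : ℝ))
    (L : Submodule ℤ (Fin m → ℝ)) [DiscreteTopology L] [IsZLattice ℝ L]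
    (hmem : ∀ k : Fin m → ℤ, (fun i => (k i : ℝ)) ∈ L) :
    Summable fun k : Fin m → ℤ => ‖(fun i => (k i : ℝ))‖ ^ r := by
  have hrk : Module.finrank ℤ L = m := by
    rw [ZLattice.rank ℝ L, Module.finrank_fin_fun]
  have h := ZLattice.summable_norm_rpow L r (by rw [hrk]; exact hr)
  have hf : Function.Injective
      (fun k : Fin m → ℤ => (⟨fun i => (k i : ℝ), hmem k⟩ : L)) := by
    intro k l hkl
    funext i
    have := congrFun (congrArg Subtype.val hkl) i
    exact Int.cast_injective this
  have h2 := h.comp_injective hf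
  exact h2

lemma summable_lattice (m : ℕ) (r : ℝ) (hr : r < -(m : ℝ)) :
    Summable fun k : Fin m → ℤ => ‖(fun i => (k i : ℝ))‖ ^ r := by
  refine summable_lattice_aux m r hr (Submodule.span ℤ (Set.range (Pi.basisFun ℝ (Fin m)))) ?_
  intro k
  rw [Module.Basis.mem_span_iff_repr_mem]
  intro i
  exact ⟨k i, by simp⟩

/-- Abundance of Diophantine rotation numbers: if `ω` satisfies `|⟨k,ω⟩| ≥ c₁/|k|^τ` for
all nonzero `k ∈ ℤ^m` and `σ > m + τ`, then for some `c₀ > 0` the set of `γ₀ ∈ [a,b]`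
satisfying the Diophantine condition `DC(c₀,σ)` has positive Lebesgue measure. -/
theorem stmt_2 (m : ℕ) (hm : 1 ≤ m) (σ : ℝ) (hσ : 0 < σ)
    (a b : ℝ) (ha : 0 < a) (hab : a < b)
    (ω : Fin m → ℝ) (c₁ τ : ℝ) (hc₁ : 0 < c₁) (hτ : 0 ≤ τ)
    (hστ : (m : ℝ) + τ < σ)
    (hω : ∀ k : Fin m → ℤ, k ≠ 0 →
      c₁ / (∑ i, (|k i| : ℝ)) ^ τ ≤ |∑ i, (k i : ℝ) * ω i|) :
    ∃ c₀ : ℝ, 0 < c₀ ∧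
      0 < volume {γ₀ : ℝ | γ₀ ∈ Set.Icc a b ∧
        ∀ k : Fin m → ℤ, k ≠ 0 → ∀ j : ℤ,
          c₀ / (∑ i, (|k i| : ℝ)) ^ σ ≤
            |(∑ i, (k i : ℝ) * ω i) * γ₀ / (2 * Real.pi) - (j : ℝ)|} := by
  have hπ := Real.pi_pos
  set g : (Fin m → ℤ) → ℝ := fun k => ‖(fun i => (k i : ℝ))‖ ^ (τ - σ) with hg
  have hsum : Summable g := summable_lattice m (τ - σ) (by linarith)
  have hg0 : ∀ k, 0 ≤ g k := fun k => by positivity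
  set S := ∑' k, g k with hS
  have hS0 : 0 ≤ S := tsum_nonneg hg0
  set C : ℝ := 2 * (b - a) + 12 * Real.pi / c₁ with hC
  have hba : 0 < b - a := by linarith
  have hC0 : 0 < C := by positivity
  set c₀ : ℝ := min 1 ((b - a) / (2 * (C * S + 1))) with hc
  have hc0 : 0 < c₀ := by
    apply lt_min one_pos
    positivity
  have hc1 : c₀ ≤ 1 := min_le_left _ _
  have hc2 : c₀ * (C * S) < b - a := by
    have h1 : c₀ ≤ (b - a) / (2 * (C * S + 1)) := min_le_right _ _
    rw [le_div_iff₀ (by positivity)] at h1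
    have : 0 ≤ c₀ * (C * S) := by positivity
    nlinarith
  refine ⟨c₀, hc0, ?_⟩
  set G := {γ₀ : ℝ | γ₀ ∈ Set.Icc a b ∧
        ∀ k : Fin m → ℤ, k ≠ 0 → ∀ j : ℤ,
          c₀ / (∑ i, (|k i| : ℝ)) ^ σ ≤
            |(∑ i, (k i : ℝ) * ω i) * γ₀ / (2 * Real.pi) - (j : ℝ)|} with hG
  set B : (Fin m → ℤ) → Set ℝ := fun k => {γ₀ : ℝ | k ≠ 0 ∧ γ₀ ∈ Set.Icc a b ∧ ∃ j : ℤ,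
      |(∑ i, (k i : ℝ) * ω i) * γ₀ / (2 * Real.pi) - (j : ℝ)| < c₀ / (∑ i, (|k i| : ℝ)) ^ σ}
    with hB
  have hcover : Set.Icc a b ⊆ G ∪ ⋃ k, B k := by
    intro γ hγ
    by_cases h : γ ∈ G
    · exact Or.inl h
    · right
      simp only [hG, Set.mem_ofPred_eq, not_and, not_forall, not_le] at h
      obtain ⟨k, hk, j, hj⟩ := h hγ
      exact Set.mem_iUnion.2 ⟨k, hk, hγ, j, hj⟩
  have hBk : ∀ k, volume (B k) ≤ ENNReal.ofReal (c₀ * C * g k) := by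
    intro k
    by_cases hk : k = 0
    · have : B k = ∅ := by ext; simp [hB, hk]
      rw [this]; simp
    set N : ℝ := ∑ i, (|k i| : ℝ) with hN
    set n : ℝ := ‖(fun i => (k i : ℝ))‖ with hn
    have hn1 : 1 ≤ n := by
      obtain ⟨i, hi⟩ := Function.ne_iff.1 hk
      have h1 : ‖(k i : ℝ)‖ ≤ n := norm_le_pi_norm (fun i => (k i : ℝ)) i
      have h2 : (1 : ℝ) ≤ ‖(k i : ℝ)‖ := by
        rw [Real.norm_eq_abs]
        exact_mod_cast Int.one_le_abs hi
      linarith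
    have hnN : n ≤ N := by
      refine (pi_norm_le_iff_of_nonneg (by positivity)).2 fun i => ?_
      rw [Real.norm_eq_abs]
      exact Finset.single_le_sum (f := fun i => |(k i : ℝ)|) (fun i _ => abs_nonneg _)
        (Finset.mem_univ i)
    have hN1 : 1 ≤ N := hn1.trans hnN
    have hN0 : 0 < N := by linarith
    set s : ℝ := ∑ i, (k i : ℝ) * ω i with hs
    have hsk : c₁ / N ^ τ ≤ |s| := hω k hk
    have hNτ : 0 < N ^ τ := by positivity
    have hNσ : 1 ≤ N ^ σ := Real.one_le_rpow hN1 hσ.le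
    have hs0 : 0 < |s| := lt_of_lt_of_le (by positivity) hsk
    set α := |s| / (2 * Real.pi) with hα
    have hα0 : 0 < α := by positivity
    set ε := c₀ / N ^ σ with hε
    have hε0 : 0 < ε := by positivity
    have hε1 : ε ≤ 1 := by
      rw [hε, div_le_one (by positivity)]; linarith
    have hsub : B k ⊆ {γ : ℝ | γ ∈ Set.Icc a b ∧ ∃ j : ℤ, |α * γ - j| < ε} := by
      rintro γ ⟨_, hγ, j, hj⟩
      refine ⟨hγ, ?_⟩
      change |s * γ / (2 * Real.pi) - (j : ℝ)| < ε at hj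
      rcases abs_cases s with h | h
      · refine ⟨j, ?_⟩
        rw [hα, h.1]
        convert hj using 2
        ring
      · refine ⟨-j, ?_⟩
        rw [hα, h.1, ← abs_neg]
        convert hj using 2
        push_cast
        ring
    refine (measure_mono hsub).trans ((bad_one a b α ε hab hα0 hε0).trans ?_)
    apply ENNReal.ofReal_le_ofReal
    have hinv : 1 / α ≤ 2 * Real.pi / c₁ * N ^ τ := by
      rw [div_le_iff₀ hNτ] at hsk
      rw [hα, one_div_div, div_mul_eq_mul_div, div_le_div_iff₀ hs0 hc₁]
      nlinarith
    have hNτ1 : 1 ≤ N ^ τ := Real.one_le_rpow hN1 hτ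
    calc 2 * ε / α * (α * (b - a) + 2 * ε + 1)
        = ε * (2 * (b - a) + 2 * (2 * ε + 1) * (1 / α)) := by field_simp; ring
      _ ≤ ε * (2 * (b - a) * N ^ τ + 2 * (2 * 1 + 1) * (2 * Real.pi / c₁ * N ^ τ)) := by
        have h1 : 2 * (b - a) ≤ 2 * (b - a) * N ^ τ :=
          le_mul_of_one_le_right (by positivity) hNτ1
        have h2 : 2 * (2 * ε + 1) * (1 / α) ≤ 2 * (2 * 1 + 1) * (2 * Real.pi / c₁ * N ^ τ) := by
          gcongr
        exact mul_le_mul_of_nonneg_left (add_le_add h1 h2) hε0.le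
      _ = c₀ * C * (N ^ τ / N ^ σ) := by rw [hε, hC]; ring
      _ = c₀ * C * N ^ (τ - σ) := by rw [Real.rpow_sub hN0]
      _ ≤ c₀ * C * g k := by
        gcongr
        have hm' : (0 : ℝ) ≤ m := by positivity
        exact Real.rpow_le_rpow_of_nonpos (by linarith) hnN (by linarith)
  have hbad : volume (⋃ k, B k) < ENNReal.ofReal (b - a) := by
    calc volume (⋃ k, B k) ≤ ∑' k, volume (B k) := measure_iUnion_le _
      _ ≤ ∑' k, ENNReal.ofReal (c₀ * C * g k) := ENNReal.tsum_le_tsum hBk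
      _ = ENNReal.ofReal (∑' k, c₀ * C * g k) :=
        (ENNReal.ofReal_tsum_of_nonneg (fun k => by have := hg0 k; positivity)
          (hsum.mul_left _)).symm
      _ < _ := by
        rw [tsum_mul_left, ENNReal.ofReal_lt_ofReal_iff hba, mul_assoc]
        exact hc2
  by_contra hzero
  have hz : volume G = 0 := by simpa using hzero
  have h1 : volume (Set.Icc a b) ≤ volume G + volume (⋃ k, B k) :=
    (measure_mono hcover).trans (measure_union_le _ _)
  rw [hz, zero_add, Real.volume_Icc] at h1
  exact absurd hbad (not_lt.2 h1)
end

section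
/- Let m ≥ 1, c₀ > 0, σ > 0, ω ∈ ℝ^m and γ₀ ∈ ℝ satisfy the Diophantine condition DC(c₀, σ). Let H, U : ℝ^m → ℂ be continuous, 2π-periodic in each variable, with [U] = 0, satisfying U(x + γ₀ω) − U(x) = H(x) for all x ∈ ℝ^m. If H(−x − γ₀ω) = H(x) for all x, then U(−x) = −U(x) for all x; and if H(−x − γ₀ω) = −H(x) for all x, then U(−x) = U(x) for all x. -/
open scoped BigOperators
open MeasureTheory

noncomputable section Aux

local instance auxMeasureSpace : MeasureSpace UnitAddCircle := ⟨AddCircle.haarAddCircle⟩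

local instance auxHaar : Measure.IsAddHaarMeasure (volume : Measure UnitAddCircle) :=
  inferInstanceAs (Measure.IsAddHaarMeasure AddCircle.haarAddCircle)

local instance auxProb : IsProbabilityMeasure (volume : Measure UnitAddCircle) :=
  inferInstanceAs (IsProbabilityMeasure AddCircle.haarAddCircle)

/-- A continuous function on the torus invariant under a nonresonant shift is constant. -/
theorem aux_const {m : ℕ} (f : C(UnitAddTorus (Fin m), ℂ)) (a : UnitAddTorus (Fin m))
    (hf : ∀ y, f (y + a) = f y)
    (ha : ∀ n : Fin m → ℤ, n ≠ 0 → UnitAddTorus.mFourier n a ≠ 1)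
    (x y : UnitAddTorus (Fin m)) : f x = f y := by
  have hz : ∀ n : Fin m → ℤ, n ≠ 0 → UnitAddTorus.mFourierCoeff f n = 0 := by
    intro n hn
    have hmul : ∀ t, UnitAddTorus.mFourier (-n) (t + a)
        = UnitAddTorus.mFourier (-n) a * UnitAddTorus.mFourier (-n) t := by
      intro t
      simp only [UnitAddTorus.mFourier, ContinuousMap.coe_mk, ← Finset.prod_mul_distrib]
      refine Finset.prod_congr rfl fun i _ => ?_
      rw [Pi.add_apply, fourier_apply, fourier_apply, fourier_apply, smul_add,
        AddCircle.toCircle_add, Circle.coe_mul, mul_comm]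
    have h1 : UnitAddTorus.mFourierCoeff f n
        = UnitAddTorus.mFourier (-n) a * UnitAddTorus.mFourierCoeff f n := by
      conv_lhs => rw [UnitAddTorus.mFourierCoeff]
      have := integral_add_right_eq_self (μ := (volume : Measure (UnitAddTorus (Fin m))))
        (fun t => UnitAddTorus.mFourier (-n) t • f t) a
      refine (Eq.trans this.symm ?_)
      rw [UnitAddTorus.mFourierCoeff, ← integral_const_mul]
      refine integral_congr_ae (Filter.Eventually.of_forall fun t => ?_)
      simp only [hmul, hf, smul_eq_mul, mul_assoc]
    have h2 := ha (-n) (neg_ne_zero.mpr hn)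
    have h3 : (UnitAddTorus.mFourier (-n) a - 1) * UnitAddTorus.mFourierCoeff f n = 0 := by
      linear_combination -h1
    exact (mul_eq_zero.mp h3).resolve_left (sub_ne_zero.mpr h2)
  have hs : Summable (UnitAddTorus.mFourierCoeff f) :=
    (hasSum_single 0 fun n hn => hz n hn).summable
  have hv : ∀ x, f x = UnitAddTorus.mFourierCoeff f 0 := by
    intro x
    have h := UnitAddTorus.hasSum_mFourier_series_apply_of_summable hs x
    have h' := hasSum_single (f := fun i =>
      UnitAddTorus.mFourierCoeff f i • UnitAddTorus.mFourier i x) 0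
      (fun n hn => by simp [hz n hn])
    rw [h.unique h']
    simp [UnitAddTorus.mFourier_zero]
  rw [hv x, hv y]

end Aux

theorem aux_period {m : ℕ} (V : (Fin m → ℝ) → ℂ)
    (hper : ∀ (x : Fin m → ℝ) (i : Fin m),
      V (Function.update x i (x i + 2 * Real.pi)) = V x)
    (k : Fin m → ℤ) (x : Fin m → ℝ) : V (x + fun i => 2 * Real.pi * k i) = V x := by
  let P : AddSubgroup (Fin m → ℝ) :=
    { carrier := {v | ∀ x, V (x + v) = V x}
      zero_mem' := by intro x; simp
      add_mem' := by
        intro a b ha hb x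
        rw [← add_assoc, hb, ha]
      neg_mem' := by
        intro a ha x
        have := ha (x + -a)
        rw [neg_add_cancel_right] at this
        exact this.symm }
  have h1 : ∀ i, (Pi.single i (2 * Real.pi) : Fin m → ℝ) ∈ P := by
    intro i x
    rw [← hper x i]
    congr 1
    ext j
    by_cases h : j = i
    · subst h; simp
    · simp [h]
  have h2 : (∑ i, k i • (Pi.single i (2 * Real.pi) : Fin m → ℝ)) ∈ P :=
    P.sum_mem fun i _ => P.zsmul_mem (h1 i) _
  have h3 : (∑ i, k i • (Pi.single i (2 * Real.pi) : Fin m → ℝ))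
      = fun i => 2 * Real.pi * k i := by
    ext j
    simp [Finset.sum_apply, Pi.single_apply, mul_comm]
  rw [h3] at h2
  exact h2 x

theorem aux_real {m : ℕ} (V : (Fin m → ℝ) → ℂ) (hc : Continuous V)
    (hper : ∀ (k : Fin m → ℤ) (x : Fin m → ℝ), V (x + fun i => 2 * Real.pi * k i) = V x)
    (a : Fin m → ℝ) (ha : ∀ x, V (x + a) = V x)
    (hn : ∀ k : Fin m → ℤ, k ≠ 0 → ∀ j : ℤ, (∑ i, k i * a i) / (2 * Real.pi) ≠ j)
    (x y : Fin m → ℝ) : V x = V y := by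
  have hpi : (2 * Real.pi) ≠ 0 := by positivity
  let q : (Fin m → ℝ) → UnitAddTorus (Fin m) := Pi.map fun _ => ((↑) : ℝ → UnitAddCircle)
  have hq : IsOpenQuotientMap q :=
    IsOpenQuotientMap.piMap fun _ => QuotientAddGroup.isOpenQuotientMap_mk
  let W : (Fin m → ℝ) → ℂ := fun z => V ((2 * Real.pi) • z)
  have hW : ∀ z w, q z = q w → W z = W w := by
    intro z w h
    have h' : ∀ i, ∃ k : ℤ, z i = w i + k := by
      intro i
      have : (z i : UnitAddCircle) = (w i : UnitAddCircle) := congrFun h i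
      rw [← sub_eq_zero, ← AddCircle.coe_sub, AddCircle.coe_eq_zero_iff] at this
      obtain ⟨k, hk⟩ := this
      refine ⟨k, ?_⟩
      simp at hk
      linarith
    choose k hk using h'
    simp only [W]
    rw [← hper k ((2 * Real.pi) • w)]
    congr 1
    ext i
    simp [hk i]
    ring
  let g : UnitAddTorus (Fin m) → ℂ := fun t => W (Function.surjInv hq.surjective t)
  have hg : ∀ z, g (q z) = W z := fun z => hW _ _ (Function.surjInv_eq hq.surjective _)
  have hgc : Continuous g := by
    rw [← hq.continuous_comp_iff]
    have : g ∘ q = W := funext hg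
    rw [this]
    exact hc.comp (continuous_const_smul _)
  have hqa : ∀ z w, q (z + w) = q z + q w := by
    intro z w; ext i; simp [q]
  have key := aux_const ⟨g, hgc⟩ (q ((2 * Real.pi)⁻¹ • a)) (by
    intro t
    obtain ⟨z, rfl⟩ := hq.surjective t
    simp only [ContinuousMap.coe_mk]
    rw [← hqa, hg, hg]
    simp only [W]
    rw [smul_add, smul_inv_smul₀ hpi, ha]) (by
    intro n hn0 h
    simp only [UnitAddTorus.mFourier, ContinuousMap.coe_mk, q, Pi.map_apply,
      fourier_coe_apply] at h
    rw [← Complex.exp_sum, Complex.exp_eq_one_iff] at h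
    obtain ⟨j, hj⟩ := h
    apply hn n hn0 j
    have hI : (2 * Real.pi * Complex.I : ℂ) ≠ 0 := Complex.two_pi_I_ne_zero
    have e : (∑ i, 2 * Real.pi * Complex.I * (n i : ℂ) *
        (((2 * Real.pi)⁻¹ • a) i : ℝ) / (1 : ℝ) : ℂ)
        = (((∑ i, n i * a i) / (2 * Real.pi) : ℝ) : ℂ) * (2 * Real.pi * Complex.I) := by
      push_cast
      rw [Finset.sum_div, Finset.sum_mul]
      refine Finset.sum_congr rfl fun i _ => ?_
      simp
      field_simp
    rw [e] at hj
    have := mul_right_cancel₀ hI hj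
    exact_mod_cast this)
  have := key (q ((2 * Real.pi)⁻¹ • x)) (q ((2 * Real.pi)⁻¹ • y))
  simp only [ContinuousMap.coe_mk] at this
  rw [hg, hg] at this
  simpa only [W, smul_inv_smul₀ hpi] using this

/-- Parity of solutions of the homological equation: under the Diophantine condition, if
`U` is a continuous torus function with zero mean solving `U(x+γ₀ω) − U(x) = H(x)`, then
`U` is odd when `H(−x−γ₀ω) = H(x)` and even when `H(−x−γ₀ω) = −H(x)`. -/
theorem stmt_5 (m : ℕ) (hm : 1 ≤ m) (c₀ σ : ℝ) (hc₀ : 0 < c₀) (hσ : 0 < σ)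
    (ω : Fin m → ℝ) (γ₀ : ℝ)
    (hDC : ∀ k : Fin m → ℤ, k ≠ 0 → ∀ j : ℤ,
      c₀ / (∑ i, (|k i| : ℝ)) ^ σ ≤
        |(∑ i, (k i : ℝ) * ω i) * γ₀ / (2 * Real.pi) - (j : ℝ)|)
    (H U : (Fin m → ℝ) → ℂ) (hHcont : Continuous H) (hUcont : Continuous U)
    (hHper : ∀ (x : Fin m → ℝ) (i : Fin m),
      H (Function.update x i (x i + 2 * Real.pi)) = H x)
    (hUper : ∀ (x : Fin m → ℝ) (i : Fin m),
      U (Function.update x i (x i + 2 * Real.pi)) = U x)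
    (hUmean : ((2 * Real.pi) ^ m : ℝ)⁻¹ •
      (∫ x in Set.Icc (0 : Fin m → ℝ) (fun _ => 2 * Real.pi), U x) = 0)
    (hEq : ∀ x : Fin m → ℝ, U (x + γ₀ • ω) - U x = H x) :
    ((∀ x : Fin m → ℝ, H (-x - γ₀ • ω) = H x) → ∀ x : Fin m → ℝ, U (-x) = -U x) ∧
    ((∀ x : Fin m → ℝ, H (-x - γ₀ • ω) = -H x) → ∀ x : Fin m → ℝ, U (-x) = U x) := by
  have hper := aux_period U hUper
  have hn : ∀ k : Fin m → ℤ, k ≠ 0 → ∀ j : ℤ,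
      (∑ i, (k i : ℝ) * (γ₀ • ω) i) / (2 * Real.pi) ≠ j := by
    intro k hk j h
    have h1 := hDC k hk j
    have e : (∑ i, (k i : ℝ) * (γ₀ • ω) i) = (∑ i, (k i : ℝ) * ω i) * γ₀ := by
      rw [Finset.sum_mul]
      refine Finset.sum_congr rfl fun i _ => ?_
      simp only [Pi.smul_apply, smul_eq_mul]
      ring
    rw [e] at h
    rw [h, sub_self, abs_zero] at h1
    have hpos : 0 < ∑ i, |(k i : ℝ)| := by
      obtain ⟨i, hi⟩ := Function.ne_iff.mp hk
      refine Finset.sum_pos' (fun _ _ => abs_nonneg _) ⟨i, Finset.mem_univ i, ?_⟩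
      exact abs_pos.mpr (Int.cast_ne_zero.mpr hi)
    have : 0 < c₀ / (∑ i, |(k i : ℝ)|) ^ σ := div_pos hc₀ (Real.rpow_pos_of_pos hpos _)
    linarith
  have hpern : ∀ (k : Fin m → ℤ) (x : Fin m → ℝ),
      U (-(x + fun i => 2 * Real.pi * k i)) = U (-x) := by
    intro k x
    rw [← hper (-k) (-x)]
    congr 1
    ext i
    simp
    ring
  have hneg : ∀ x, H (-x - γ₀ • ω) = U (-x) - U (-(x + γ₀ • ω)) := by
    intro x
    rw [← hEq, sub_add_cancel, neg_add']
  have hUn : Continuous fun x => U (-x) := hUcont.comp continuous_neg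
  constructor
  · intro h x
    have hc := aux_real (fun x => U (-x) + U x) (hUn.add hUcont)
      (fun k x => by simp only [hper, hpern]) (γ₀ • ω)
      (fun x => by
        have h1 := h x
        rw [hneg, ← hEq] at h1
        linear_combination -h1) hn
    have hpi : 0 < 2 * Real.pi := by positivity
    set b : Fin m → ℝ := fun _ => 2 * Real.pi with hb
    have hU0 : ∫ x in Set.Icc (0 : Fin m → ℝ) b, U x = 0 := by
      rcases smul_eq_zero.mp hUmean with h0 | h0
      · exact absurd h0 (by positivity)
      · exact h0
    have hUn0 : ∫ x in Set.Icc (0 : Fin m → ℝ) b, U (-x) = 0 := by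
      rw [← hU0, ← integral_indicator measurableSet_Icc, ← integral_indicator measurableSet_Icc,
        ← integral_sub_left_eq_self _ volume b]
      refine integral_congr_ae (Filter.Eventually.of_forall fun x => ?_)
      have hm : (b - x ∈ Set.Icc (0 : Fin m → ℝ) b) ↔ x ∈ Set.Icc (0 : Fin m → ℝ) b := by
        simp [Set.mem_Icc, and_comm]
      have hx : U (-(b - x)) = U x := by
        rw [← hper (fun _ => -1) x]
        congr 1
        ext i
        simp [hb]
        ring
      beta_reduce
      by_cases hxm : x ∈ Set.Icc (0 : Fin m → ℝ) b
      · rw [Set.indicator_of_mem (hm.mpr hxm), Set.indicator_of_mem hxm, hx]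
      · rw [Set.indicator_of_notMem (fun hh => hxm (hm.mp hh)), Set.indicator_of_notMem hxm]
    have hi1 : IntegrableOn U (Set.Icc (0 : Fin m → ℝ) b) :=
      hUcont.continuousOn.integrableOn_compact isCompact_Icc
    have hi2 : IntegrableOn (fun x => U (-x)) (Set.Icc (0 : Fin m → ℝ) b) :=
      hUn.continuousOn.integrableOn_compact isCompact_Icc
    have hs : ∫ y in Set.Icc (0 : Fin m → ℝ) b, (U (-y) + U y) = 0 := by
      rw [integral_add hi2 hi1, hU0, hUn0, add_zero]
    have hs2 : ∫ y in Set.Icc (0 : Fin m → ℝ) b, (U (-y) + U y)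
        = ∫ y in Set.Icc (0 : Fin m → ℝ) b, (U (-x) + U x) :=
      integral_congr_ae (Filter.Eventually.of_forall fun y => hc y x)
    rw [hs2, setIntegral_const] at hs
    have hvol : volume.real (Set.Icc (0 : Fin m → ℝ) b) ≠ 0 := by
      rw [measureReal_def, Real.volume_Icc_pi_toReal (fun i => by simp [hb, hpi.le])]
      simp [hb, Finset.prod_const, Real.pi_ne_zero]
    exact eq_neg_of_add_eq_zero_left ((smul_eq_zero.mp hs).resolve_left hvol)
  · intro h x
    have hc := aux_real (fun x => U (-x) - U x) (hUn.sub hUcont)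
      (fun k x => by simp only [hper, hpern]) (γ₀ • ω)
      (fun x => by
        have h1 := h x
        rw [hneg, ← hEq] at h1
        linear_combination -h1) hn x 0
    simp only [neg_zero, sub_self] at hc
    exact sub_eq_zero.mp hc
end

section
/- Let m ≥ 1, c₀ > 0, σ > 0, ω ∈ ℝ^m and γ₀ ∈ ℝ satisfy the Diophantine condition DC(c₀, σ). Then for every C^∞ function F : ℝ^m → ℝ that is 2π-periodic in each variable, there exists a unique C^∞ function G : ℝ^m → ℝ, 2π-periodic in each variable with zero mean [G] = 0, such that F(x) = [F] + G(x) − G(x + γ₀ω) for all x ∈ ℝ^m. -/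
open scoped BigOperators
open MeasureTheory

namespace Coh

open scoped Pointwise

attribute [local instance] instMeasureSpaceUnitAddCircle
attribute [local instance] instIsAddHaarMeasureUnitAddCircleVolume
attribute [local instance] instIsProbabilityMeasureUnitAddCircleVolume

noncomputable section

variable {m : ℕ}

/-- The character with frequency `k` (period one). -/
def ch (k : Fin m → ℤ) (x : Fin m → ℝ) : ℂ :=
  Complex.exp (2 * Real.pi * Complex.I * ((∑ i, (k i : ℝ) * x i : ℝ) : ℂ))

/-- One-periodicity with respect to the lattice. -/
def Per (p : (Fin m → ℝ) → ℂ) : Prop :=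
  ∀ (x : Fin m → ℝ) (n : Fin m → ℤ), p (x + fun i => (n i : ℝ)) = p x

/-- The projection to the torus. -/
def proj (x : Fin m → ℝ) : UnitAddTorus (Fin m) := fun i => (x i : UnitAddCircle)

/-- The function on the torus induced by a periodic function. -/
def lift (p : (Fin m → ℝ) → ℂ) (t : UnitAddTorus (Fin m)) : ℂ :=
  p (fun i => (AddCircle.equivIoc 1 0 (t i)).1)

/-- The unit box. -/
def box (m : ℕ) : Set (Fin m → ℝ) := {x | ∀ i, x i ∈ Set.Ioc (0 : ℝ) (0 + 1)}

/-- The Fourier coefficients. -/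
def coef (p : (Fin m → ℝ) → ℂ) (k : Fin m → ℤ) : ℂ :=
  UnitAddTorus.mFourierCoeff (lift p) k

lemma lift_proj {p : (Fin m → ℝ) → ℂ} (hp : Per p) (x : Fin m → ℝ) :
    lift p (proj x) = p x := by
  have h : ∀ i, ∃ n : ℤ, (AddCircle.equivIoc (1:ℝ) 0 (x i : UnitAddCircle)).1 = x i + n := by
    intro i
    have h1 : (((AddCircle.equivIoc (1:ℝ) 0 (x i : UnitAddCircle)).1 : ℝ) : UnitAddCircle)
        = (x i : UnitAddCircle) := AddCircle.coe_equivIoc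
    rw [← sub_eq_zero, ← AddCircle.coe_sub, AddCircle.coe_eq_zero_iff] at h1
    obtain ⟨n, hn⟩ := h1
    refine ⟨n, ?_⟩
    rw [zsmul_eq_mul, mul_one] at hn
    linarith
  choose n hn using h
  unfold lift proj
  rw [show (fun i => (AddCircle.equivIoc (1:ℝ) 0 (x i : UnitAddCircle)).1)
    = x + fun i => (n i : ℝ) from funext hn]
  exact hp x n

lemma proj_quot : IsOpenQuotientMap (proj (m := m)) := by
  have := IsOpenQuotientMap.piMap (ι := Fin m)
    (f := fun _ => fun y : ℝ => (y : UnitAddCircle)) (fun _ => QuotientAddGroup.isOpenQuotientMap_mk)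
  exact this

lemma lift_cont {p : (Fin m → ℝ) → ℂ} (hp : Per p) (hc : Continuous p) : Continuous (lift p) := by
  rw [proj_quot.isQuotientMap.continuous_iff]
  rw [show lift p ∘ proj = p from funext (lift_proj hp)]
  exact hc

lemma mFourier_proj (k : Fin m → ℤ) (x : Fin m → ℝ) :
    UnitAddTorus.mFourier k (proj x) = ch k x := by
  simp only [UnitAddTorus.mFourier, ContinuousMap.coe_mk, proj, fourier_coe_apply, ch]
  rw [← Complex.exp_sum]
  congr 1
  push_cast
  rw [Finset.mul_sum]
  refine Finset.sum_congr rfl fun i _ => by ring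

lemma coef_eq {p : (Fin m → ℝ) → ℂ} (hp : Per p) (k : Fin m → ℤ) :
    coef p k = ∫ x in box m, ch (-k) x * p x := by
  rw [coef, UnitAddTorus.mFourierCoeff_eq_integral _ _ (fun _ => 0)]
  unfold box
  congr 1
  ext x
  rw [show (fun i => (x i : UnitAddCircle)) = proj x from rfl, mFourier_proj, lift_proj hp,
    smul_eq_mul]

lemma ch_add (k : Fin m → ℤ) (x y : Fin m → ℝ) : ch k (x + y) = ch k x * ch k y := by
  unfold ch
  rw [← Complex.exp_add]
  congr 1
  simp only [Pi.add_apply, mul_add, Finset.sum_add_distrib]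
  push_cast
  ring

lemma ch_neg_mul (k : Fin m → ℤ) (x : Fin m → ℝ) : ch (-k) x * ch k x = 1 := by
  unfold ch
  rw [← Complex.exp_add]
  simp

lemma ch_norm (k : Fin m → ℤ) (x : Fin m → ℝ) : ‖ch k x‖ = 1 := by
  unfold ch
  rw [show (2 * Real.pi * Complex.I * ((∑ i, (k i : ℝ) * x i : ℝ) : ℂ))
    = ((2 * Real.pi * ∑ i, (k i : ℝ) * x i : ℝ) : ℂ) * Complex.I by push_cast; ring]
  exact Complex.norm_exp_ofReal_mul_I _

lemma ch_int (k n : Fin m → ℤ) : ch k (fun i => (n i : ℝ)) = 1 := by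
  unfold ch
  rw [Complex.exp_eq_one_iff]
  exact ⟨∑ i, k i * n i, by push_cast; ring⟩

lemma ch_per (k : Fin m → ℤ) : Per (ch k) := by
  intro x n
  rw [ch_add, ch_int, mul_one]

lemma ch_cont (k : Fin m → ℤ) : Continuous (ch k) := by
  unfold ch
  fun_prop

lemma coef_translate {p : (Fin m → ℝ) → ℂ} (hp : Per p) (k : Fin m → ℤ) (h : Fin m → ℝ) :
    coef (fun x => p (x + h)) k = ch k h * coef p k := by
  have hp' : Per (fun x => p (x + h)) := by
    intro x n
    simp only
    rw [add_right_comm, hp]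
  have key : ∀ t, UnitAddTorus.mFourier (-k) t • lift (fun x => p (x + h)) t
      = ch k h * (UnitAddTorus.mFourier (-k) (t + proj h) • lift p (t + proj h)) := by
    intro t
    obtain ⟨x, rfl⟩ := proj_quot.surjective t
    have : proj x + proj h = proj (x + h) := rfl
    rw [this, lift_proj hp, lift_proj hp', mFourier_proj, mFourier_proj, ch_add]
    have := ch_neg_mul k h
    simp only [smul_eq_mul]
    linear_combination (-(ch (-k) x * p (x + h))) * this
  unfold coef UnitAddTorus.mFourierCoeff
  simp_rw [key]
  rw [integral_const_mul]
  congr 1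
  exact integral_add_right_eq_self (fun t => UnitAddTorus.mFourier (-k) t • lift p t) (proj h)

lemma hasSum_coef {p : (Fin m → ℝ) → ℂ} (hp : Per p) (hc : Continuous p)
    (hs : Summable (coef p)) (x : Fin m → ℝ) : HasSum (fun k => coef p k * ch k x) (p x) := by
  have := UnitAddTorus.hasSum_mFourier_series_apply_of_summable
    (f := ⟨lift p, lift_cont hp hc⟩) hs (proj x)
  simp only [mFourier_proj, ContinuousMap.coe_mk, lift_proj hp] at this
  exact this

lemma per_bdd {p : (Fin m → ℝ) → ℂ} (hp : Per p) (hc : Continuous p) :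
    ∃ C, ∀ x, ‖p x‖ ≤ C := by
  refine ⟨‖(⟨lift p, lift_cont hp hc⟩ : C(UnitAddTorus (Fin m), ℂ))‖, fun x => ?_⟩
  rw [← lift_proj hp]
  exact ContinuousMap.norm_coe_le_norm ⟨lift p, lift_cont hp hc⟩ (proj x)

instance : IsFiniteMeasure (volume.restrict (box m)) := by
  refine ⟨?_⟩
  rw [Measure.restrict_apply_univ]
  refine lt_of_le_of_lt (measure_mono (t := Set.Icc (0 : Fin m → ℝ) 1) ?_)
    isCompact_Icc.measure_lt_top
  intro x hx
  exact ⟨fun i => (hx i).1.le, fun i => by simpa using (hx i).2⟩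

lemma coef_bdd {p : (Fin m → ℝ) → ℂ} (hp : Per p) (hc : Continuous p) :
    ∃ C, ∀ k, ‖coef p k‖ ≤ C := by
  obtain ⟨C, hC⟩ := per_bdd hp hc
  refine ⟨C * (volume.restrict (box m)).real Set.univ, fun k => ?_⟩
  rw [coef_eq hp]
  apply norm_integral_le_of_norm_le_const
  refine Filter.Eventually.of_forall fun x => ?_
  rw [norm_mul, ch_norm, one_mul]
  exact hC x

/-- Partial derivative. -/
def pd (j : Fin m) (p : (Fin m → ℝ) → ℂ) (x : Fin m → ℝ) : ℂ := fderiv ℝ p x (Pi.single j 1)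

lemma pd_smooth (j : Fin m) {p : (Fin m → ℝ) → ℂ} (h : ContDiff ℝ (⊤ : ℕ∞) p) :
    ContDiff ℝ (⊤ : ℕ∞) (pd j p) := by
  unfold pd
  exact (h.fderiv_right (m := (⊤ : ℕ∞)) (by simp)).clm_apply contDiff_const

lemma pd_per (j : Fin m) {p : (Fin m → ℝ) → ℂ} (h : Per p) : Per (pd j p) := by
  intro x n
  unfold pd
  rw [← fderiv_comp_add_right]
  congr 2
  ext y
  exact h y n

lemma coef_pd (j : Fin m) {p : (Fin m → ℝ) → ℂ} (hp : Per p) (hs : ContDiff ℝ (⊤ : ℕ∞) p)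
    (k : Fin m → ℤ) : coef (pd j p) k = 2 * Real.pi * Complex.I * k j * coef p k := by
  have hpp := pd_per j hp
  have hpc := (pd_smooth j hs).continuous
  obtain ⟨C, hC⟩ := per_bdd hpp hpc
  have hd : ∀ x : Fin m → ℝ, ∀ t : ℝ, HasDerivAt (fun t : ℝ => p (x + t • Pi.single j 1))
      (pd j p (x + t • Pi.single j 1)) t := by
    intro x t
    have h1 : HasFDerivAt p (fderiv ℝ p (x + t • Pi.single j 1)) (x + t • Pi.single j 1) :=
      (hs.differentiable (by simp) _).hasFDerivAt
    have h2 : HasDerivAt (fun t : ℝ => x + t • (Pi.single j 1 : Fin m → ℝ)) (Pi.single j 1) t := by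
      simpa using ((hasDerivAt_id t).smul_const (Pi.single j 1 : Fin m → ℝ)).const_add x
    exact h1.comp_hasDerivAt t h2
  have hc := hs.continuous
  have hch := ch_cont (-k)
  have key := (hasDerivAt_integral_of_dominated_loc_of_deriv_le (μ := volume.restrict (box m))
    (F := fun (t : ℝ) x => ch (-k) x * p (x + t • Pi.single j 1))
    (F' := fun (t : ℝ) x => ch (-k) x * pd j p (x + t • Pi.single j 1))
    (x₀ := (0 : ℝ)) (s := Set.univ) (bound := fun _ => C) Filter.univ_mem
    (Filter.Eventually.of_forall fun t => (by fun_prop : Continuous _).aestronglyMeasurable)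
    (by
      obtain ⟨D, hD⟩ := per_bdd hp hc
      refine Integrable.of_bound (C := D) (by fun_prop : Continuous _).aestronglyMeasurable
        (Filter.Eventually.of_forall fun x => ?_)
      rw [norm_mul, ch_norm, one_mul]
      exact hD _)
    ((by fun_prop : Continuous _).aestronglyMeasurable)
    (Filter.Eventually.of_forall fun x t _ => by
      rw [norm_mul, ch_norm, one_mul]
      exact hC _)
    (integrable_const _)
    (Filter.Eventually.of_forall fun x t _ => (hd x t).const_mul _)).2
  have e1 : (fun t : ℝ => ∫ x in box m, ch (-k) x * p (x + t • Pi.single j 1))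
      = fun t : ℝ => Complex.exp (2 * Real.pi * Complex.I * k j * t) * coef p k := by
    ext t
    have hp' : Per (fun x => p (x + t • Pi.single j 1)) := by
      intro x n
      simp only
      rw [add_right_comm, hp]
    rw [← coef_eq hp', coef_translate hp]
    congr 1
    unfold ch
    congr 1
    rw [Finset.sum_eq_single j]
    · simp
      ring
    · intro i _ hi
      simp [hi]
    · simp
  rw [e1] at key
  simp only [zero_smul, add_zero] at key
  rw [← coef_eq hpp] at key
  refine key.unique ?_
  have h3 : HasDerivAt (fun t : ℝ => (2 * Real.pi * Complex.I * k j * (t : ℂ)))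
      (2 * Real.pi * Complex.I * k j) 0 := by
    simpa using (Complex.ofRealCLM.hasDerivAt (x := (0:ℝ))).const_mul (2 * Real.pi * Complex.I * (k j : ℂ))
  simpa using (h3.cexp).mul_const (coef p k)

/-- The `ℓ¹` size of a frequency. -/
def S (k : Fin m → ℤ) : ℝ := ∑ i, |(k i : ℝ)|

lemma S_nonneg (k : Fin m → ℤ) : 0 ≤ S k := Finset.sum_nonneg fun _ _ => abs_nonneg _

lemma le_S (k : Fin m → ℤ) (i : Fin m) : |(k i : ℝ)| ≤ S k :=
  Finset.single_le_sum (f := fun i => |(k i : ℝ)|) (fun _ _ => abs_nonneg _) (Finset.mem_univ i)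

lemma one_le_S {k : Fin m → ℤ} (hk : k ≠ 0) : 1 ≤ S k := by
  obtain ⟨i, hi⟩ := Function.ne_iff.mp hk
  refine le_trans ?_ (le_S k i)
  rw [← Int.cast_abs]
  exact_mod_cast Int.one_le_abs hi

lemma coef_decay_j (j : Fin m) (N : ℕ) : ∀ {p : (Fin m → ℝ) → ℂ} (_ : Per p)
    (_ : ContDiff ℝ (⊤ : ℕ∞) p), ∃ C, ∀ k, |(k j : ℝ)| ^ N * ‖coef p k‖ ≤ C := by
  induction N with
  | zero =>
    intro p hp hs
    simpa using coef_bdd hp hs.continuous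
  | succ N ih =>
    intro p hp hs
    obtain ⟨C, hC⟩ := ih (pd_per j hp) (pd_smooth j hs)
    refine ⟨C, fun k => le_trans ?_ (hC k)⟩
    rw [coef_pd j hp hs, pow_succ, mul_assoc]
    refine mul_le_mul_of_nonneg_left ?_ (by positivity)
    have : ‖(k j : ℂ)‖ = |(k j : ℝ)| := by
      rw [← Complex.ofReal_intCast, Complex.norm_real, Real.norm_eq_abs]
    simp only [norm_mul, Complex.norm_I, Complex.norm_ofNat, Complex.norm_real, this,
      Real.norm_eq_abs, abs_of_pos Real.pi_pos, mul_one]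
    refine mul_le_mul_of_nonneg_right ?_ (norm_nonneg _)
    have h2 : 1 ≤ 2 * Real.pi := by linarith [Real.pi_gt_three]
    exact le_mul_of_one_le_left (abs_nonneg _) h2

lemma coef_decay (hm : 1 ≤ m) {p : (Fin m → ℝ) → ℂ} (hp : Per p)
    (hs : ContDiff ℝ (⊤ : ℕ∞) p) (N : ℕ) : ∃ C, ∀ k, S k ^ N * ‖coef p k‖ ≤ C := by
  have h := fun j => coef_decay_j j N hp hs
  choose C hC using h
  have : Nonempty (Fin m) := ⟨⟨0, hm⟩⟩
  obtain ⟨jm, hjm⟩ := Finite.exists_max C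
  refine ⟨(m : ℝ) ^ N * C jm, fun k => ?_⟩
  obtain ⟨j, hj⟩ := Finite.exists_max (fun j => |(k j : ℝ)|)
  have h1 : S k ≤ m * |(k j : ℝ)| := by
    have := Finset.sum_le_card_nsmul Finset.univ (fun i => |(k i : ℝ)|) _ (fun i _ => hj i)
    simpa [S] using this
  calc S k ^ N * ‖coef p k‖ ≤ (m * |(k j : ℝ)|) ^ N * ‖coef p k‖ := by
        gcongr
        exact S_nonneg k
    _ = (m : ℝ) ^ N * (|(k j : ℝ)| ^ N * ‖coef p k‖) := by ring
    _ ≤ (m : ℝ) ^ N * C jm := by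
        gcongr
        exact (hC j k).trans (hjm j)


lemma summable_S (m : ℕ) : ∃ M : ℕ, Summable fun k : Fin m → ℤ => (S k ^ M)⁻¹ := by
  let L : Submodule ℤ (Fin m → ℝ) := Submodule.span ℤ (Set.range (Pi.basisFun ℝ (Fin m)))
  have hs := ZLattice.summable_norm_pow_inv (L := L) (Module.finrank ℤ L + 1) (Nat.lt_succ_self _)
  refine ⟨Module.finrank ℤ L + 1, ?_⟩
  have hmem : ∀ k : Fin m → ℤ, (fun i => (k i : ℝ)) ∈ L := by
    intro k
    have : (fun i => (k i : ℝ)) = ∑ i, k i • Pi.basisFun ℝ (Fin m) i := by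
      ext j
      simp [Finset.sum_apply, Pi.single_apply]
    rw [this]
    exact Submodule.sum_mem _ fun i _ => Submodule.smul_mem _ _ (Submodule.subset_span ⟨i, rfl⟩)
  let φ : (Fin m → ℤ) → L := fun k => ⟨fun i => (k i : ℝ), hmem k⟩
  have hφ : Function.Injective φ := by
    intro k l h
    ext i
    have : (k i : ℝ) = (l i : ℝ) := congrFun (congrArg Subtype.val h) i
    exact_mod_cast this
  refine Summable.of_nonneg_of_le (fun k => by have := S_nonneg k; positivity) (fun k => ?_)
    (hs.comp_injective hφ)
  by_cases hk : k = 0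
  · subst hk
    simp [S]
  · have hn : ‖φ k‖ ≤ S k := by
      change ‖(fun i => (k i : ℝ))‖ ≤ S k
      rw [pi_norm_le_iff_of_nonneg (S_nonneg k)]
      exact fun i => le_S k i
    have hpos : 0 < ‖φ k‖ := by
      rw [norm_pos_iff]
      intro h
      apply hk
      apply hφ
      rw [h]
      ext i
      simp [φ]
    simp only [Function.comp_apply]
    first
      | exact inv_anti₀ (by positivity) (pow_le_pow_left₀ hpos.le hn _)
      | (rw [inv_pow]; exact inv_anti₀ (by positivity) (pow_le_pow_left₀ hpos.le hn _))

/-- Rapid decay. -/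
def Rapid (c : (Fin m → ℤ) → ℂ) : Prop := ∀ N : ℕ, ∃ C, ∀ k, S k ^ N * ‖c k‖ ≤ C

lemma Rapid.summable {c : (Fin m → ℤ) → ℂ} (hc : Rapid c) (n : ℕ) :
    Summable fun k => S k ^ n * ‖c k‖ := by
  obtain ⟨M, hM⟩ := summable_S m
  obtain ⟨C, hC⟩ := hc (n + M)
  refine Summable.of_norm_bounded_eventually (hM.mul_left C) ?_
  have : ∀ᶠ k : Fin m → ℤ in Filter.cofinite, k ≠ 0 := by
    simp [Filter.eventually_cofinite]
  filter_upwards [this] with k hk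
  have h1 := one_le_S hk
  have h0 : 0 < S k := by linarith
  rw [Real.norm_of_nonneg (by positivity), ← div_eq_mul_inv, le_div_iff₀ (by positivity)]
  calc S k ^ n * ‖c k‖ * S k ^ M = S k ^ (n + M) * ‖c k‖ := by ring
    _ ≤ C := hC k

/-- The linear form with coefficients `k`. -/
def lin (k : Fin m → ℤ) : (Fin m → ℝ) →L[ℝ] ℝ :=
  ∑ i, (k i : ℝ) • ContinuousLinearMap.proj (R := ℝ) (φ := fun _ : Fin m => ℝ) i

lemma lin_apply (k : Fin m → ℤ) (x : Fin m → ℝ) : lin k x = ∑ i, (k i : ℝ) * x i := by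
  simp [lin]

lemma lin_norm (k : Fin m → ℤ) : ‖lin k‖ ≤ S k := by
  refine ContinuousLinearMap.opNorm_le_bound _ (S_nonneg k) fun x => ?_
  rw [lin_apply, S, Finset.sum_mul]
  refine (norm_sum_le _ _).trans (Finset.sum_le_sum fun i _ => ?_)
  rw [norm_mul, Real.norm_eq_abs]
  exact mul_le_mul_of_nonneg_left (norm_le_pi_norm x i) (abs_nonneg _)

lemma iteratedDeriv_ex (c : ℂ) (n : ℕ) : iteratedDeriv n (fun t : ℝ => Complex.exp (c * t))
    = fun t : ℝ => c ^ n * Complex.exp (c * t) := by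
  induction n with
  | zero => simp
  | succ n ih =>
    rw [iteratedDeriv_succ, ih]
    ext t
    have h3 : HasDerivAt (fun t : ℝ => c * (t : ℂ)) c t := by
      simpa using (Complex.ofRealCLM.hasDerivAt (x := t)).const_mul c
    rw [((h3.cexp).const_mul (c ^ n)).deriv]
    ring

lemma ex_smooth (c : ℂ) : ContDiff ℝ (⊤ : ℕ∞) (fun t : ℝ => Complex.exp (c * t)) :=
  (contDiff_const.mul Complex.ofRealCLM.contDiff).cexp

lemma ch_comp (k : Fin m → ℤ) :
    ch k = (fun t : ℝ => Complex.exp (2 * Real.pi * Complex.I * t)) ∘ lin k := by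
  ext x
  simp [ch, lin_apply]

lemma ch_smooth (k : Fin m → ℤ) : ContDiff ℝ (⊤ : ℕ∞) (ch k) := by
  rw [ch_comp]
  exact (ex_smooth _).comp (lin k).contDiff

lemma ch_deriv (k : Fin m → ℤ) (n : ℕ) (x : Fin m → ℝ) :
    ‖iteratedFDeriv ℝ n (ch k) x‖ ≤ (2 * Real.pi) ^ n * S k ^ n := by
  rw [ch_comp, ContinuousLinearMap.iteratedFDeriv_comp_right (lin k) (ex_smooth _) x
    (i := n) (by exact_mod_cast le_top)]
  refine (ContinuousMultilinearMap.norm_compContinuousLinearMap_le _ _).trans ?_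
  rw [norm_iteratedFDeriv_eq_norm_iteratedDeriv, iteratedDeriv_ex]
  have h1 : ‖Complex.exp (2 * Real.pi * Complex.I * (lin k x : ℝ))‖ = 1 := by
    have := ch_norm k x
    rw [ch_comp] at this
    exact this
  rw [norm_mul, h1, norm_pow]
  simp only [norm_mul, Complex.norm_I, Complex.norm_ofNat, Complex.norm_real,
      Real.norm_eq_abs, abs_of_pos Real.pi_pos, mul_one, Finset.prod_const, Finset.card_univ,
      Fintype.card_fin]
  gcongr
  exact lin_norm k

lemma series_smooth {c : (Fin m → ℤ) → ℂ} (hc : Rapid c) :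
    ContDiff ℝ (⊤ : ℕ∞) (fun x => ∑' k, c k * ch k x) := by
  refine contDiff_tsum (N := ⊤) (v := fun n k => (2 * Real.pi) ^ n * (S k ^ n * ‖c k‖))
    (fun k => contDiff_const.mul (ch_smooth k)) (fun n _ => (hc.summable n).mul_left _) ?_
  intro n k x _
  have : (fun x => c k * ch k x) = c k • ch k := rfl
  rw [this, iteratedFDeriv_const_smul_apply
    (((ch_smooth k).of_le (by exact_mod_cast le_top)).contDiffAt), norm_smul]
  calc ‖c k‖ * ‖iteratedFDeriv ℝ n (ch k) x‖ ≤ ‖c k‖ * ((2 * Real.pi) ^ n * S k ^ n) := by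
        gcongr
        exact ch_deriv k n x
    _ = _ := by ring

lemma series_summable {c : (Fin m → ℤ) → ℂ} (hc : Rapid c) (x : Fin m → ℝ) :
    Summable (fun k => c k * ch k x) := by
  refine Summable.of_norm ?_
  simpa [ch_norm] using hc.summable 0

lemma exists_sol (hm : 1 ≤ m) {c₀ σ : ℝ} (hc₀ : 0 < c₀) (α : Fin m → ℝ)
    (hα : ∀ k : Fin m → ℤ, k ≠ 0 → c₀ / S k ^ σ ≤ ‖1 - ch k α‖)
    {f : (Fin m → ℝ) → ℂ} (hp : Per f) (hs : ContDiff ℝ (⊤ : ℕ∞) f) :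
    ∃ g : (Fin m → ℝ) → ℂ, Per g ∧ ContDiff ℝ (⊤ : ℕ∞) g ∧
      ∀ x, f x = coef f 0 + g x - g (x + α) := by
  classical
  have hr : Rapid (coef f) := coef_decay hm hp hs
  let c : (Fin m → ℤ) → ℂ := fun k => if k = 0 then 0 else coef f k / (1 - ch k α)
  obtain ⟨n, hn⟩ := exists_nat_ge σ
  have hne : ∀ k : Fin m → ℤ, k ≠ 0 → 1 - ch k α ≠ 0 := by
    intro k hk
    have h1 := one_le_S hk
    have h2 := hα k hk
    have : 0 < c₀ / S k ^ σ := by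
      have : 0 < S k := by linarith
      positivity
    rw [← norm_pos_iff]
    linarith
  have hc : Rapid c := by
    intro N
    obtain ⟨C, hC⟩ := hr (N + n)
    refine ⟨max 0 (C / c₀), fun k => ?_⟩
    by_cases hk : k = 0
    · simp [c, hk]
    · refine le_trans ?_ (le_max_right _ _)
      have h1 := one_le_S hk
      have h0 : 0 < S k := by linarith
      have h2 := hα k hk
      have h3 : c₀ / S k ^ n ≤ ‖1 - ch k α‖ := by
        refine le_trans ?_ h2
        rw [← Real.rpow_natCast]
        gcongr
      have h4 : 0 < c₀ / S k ^ n := by positivity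
      simp only [c, hk, if_false, norm_div]
      rw [le_div_iff₀ hc₀]
      calc S k ^ N * (‖coef f k‖ / ‖1 - ch k α‖) * c₀
          ≤ S k ^ N * (‖coef f k‖ / (c₀ / S k ^ n)) * c₀ := by gcongr
        _ = S k ^ (N + n) * ‖coef f k‖ := by
            field_simp
            ring
        _ ≤ C := hC k
  refine ⟨fun x => ∑' k, c k * ch k x, ?_, series_smooth hc, fun x => ?_⟩
  · intro x l
    simp only
    refine tsum_congr fun k => ?_
    rw [ch_per]
  · have hsum : Summable (coef f) := by
      refine Summable.of_norm ?_
      simpa using hr.summable 0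
    have h1 := hasSum_coef hp hs.continuous hsum x
    have h2 := (series_summable hc x).hasSum
    have h3 := (series_summable hc (x + α)).hasSum
    have h4 := h2.sub h3
    have h5 : HasSum (fun k : Fin m → ℤ => if k = 0 then coef f 0 else 0) (coef f 0) :=
      hasSum_ite_eq 0 (coef f 0)
    have h6 := h5.add h4
    have h7 : (fun k => coef f k * ch k x) = fun k =>
        (if k = 0 then coef f 0 else 0) + (c k * ch k x - c k * ch k (x + α)) := by
      ext k
      by_cases hk : k = 0
      · subst hk
        simp [c, ch]
      · have := hne k hk
        simp only [c, hk, if_false, ch_add]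
        field_simp
        ring
    rw [h7] at h1
    rw [h1.unique h6]
    ring

lemma unique_sol {α : Fin m → ℝ} (hα : ∀ k : Fin m → ℤ, k ≠ 0 → 1 - ch k α ≠ 0)
    {d : (Fin m → ℝ) → ℂ} (hp : Per d) (hc : Continuous d) (h0 : coef d 0 = 0)
    (hd : ∀ x, d (x + α) = d x) (x : Fin m → ℝ) : d x = 0 := by
  have hz : coef d = 0 := by
    ext k
    by_cases hk : k = 0
    · rw [hk, h0]
      rfl
    · have h1 := coef_translate hp k α
      rw [show (fun x => d (x + α)) = d from funext hd] at h1
      have h2 : (1 - ch k α) * coef d k = 0 := by linear_combination h1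
      exact (mul_eq_zero.mp h2).resolve_left (hα k hk)
  have h1 := hasSum_coef hp hc (by rw [hz]; exact summable_zero) x
  rw [hz] at h1
  simp only [Pi.zero_apply, zero_mul] at h1
  exact h1.unique hasSum_zero

lemma dioph {t s : ℝ} (h : ∀ j : ℤ, s ≤ |t - (j : ℝ)|) :
    s ≤ ‖1 - Complex.exp (2 * Real.pi * Complex.I * (t : ℂ))‖ := by
  have h1 := h (round t)
  have h2 : Complex.exp (2 * Real.pi * Complex.I * (t : ℂ))
      = Complex.exp (Complex.I * ((2 * Real.pi * (t - round t) : ℝ) : ℂ)) := by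
    rw [Complex.exp_eq_exp_iff_exists_int]
    refine ⟨round t, ?_⟩
    push_cast
    ring
  rw [h2, norm_sub_rev, Complex.norm_exp_I_mul_ofReal_sub_one]
  have h3 := abs_sub_round t
  have hpi := Real.pi_pos
  have h4 : |Real.pi * (t - round t)| = Real.pi * |t - round t| := by
    rw [abs_mul, abs_of_pos hpi]
  have h5 := Real.mul_abs_le_abs_sin (x := Real.pi * (t - round t)) (by rw [h4]; nlinarith)
  rw [h4] at h5
  have h6 : 2 / Real.pi * (Real.pi * |t - round t|) = 2 * |t - round t| := by
    field_simp
  rw [norm_mul, Real.norm_eq_abs, Real.norm_eq_abs, abs_two,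
    show 2 * Real.pi * (t - round t) / 2 = Real.pi * (t - round t) by ring]
  have := abs_nonneg (t - round t)
  linarith

/-- Rescaled complexification. -/
def cpx (G : (Fin m → ℝ) → ℝ) (x : Fin m → ℝ) : ℂ := (G ((2 * Real.pi) • x) : ℂ)

lemma cpx_smooth {G : (Fin m → ℝ) → ℝ} (h : ContDiff ℝ (⊤ : ℕ∞) G) :
    ContDiff ℝ (⊤ : ℕ∞) (cpx G) :=
  Complex.ofRealCLM.contDiff.comp (h.comp (contDiff_const_smul _))

lemma update_eq (x : Fin m → ℝ) (i : Fin m) (a : ℝ) :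
    Function.update x i (x i + a) = x + a • Pi.single i 1 := by
  ext j
  by_cases hj : j = i
  · subst hj
    simp
  · simp [hj]

lemma cpx_per {G : (Fin m → ℝ) → ℝ} (h : ∀ (x : Fin m → ℝ) (i : Fin m),
      G (Function.update x i (x i + 2 * Real.pi)) = G x) : Per (cpx G) := by
  let H : AddSubgroup (Fin m → ℝ) :=
    { carrier := {v | ∀ x, G (x + v) = G x}
      zero_mem' := by intro x; simp
      add_mem' := by
        intro a b ha hb x
        rw [← add_assoc, hb, ha]
      neg_mem' := by
        intro a ha x
        have := ha (x + -a)
        rw [neg_add_cancel_right] at this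
        exact this.symm }
  intro x n
  have hmem : (2 * Real.pi) • (fun i => (n i : ℝ)) ∈ H := by
    have : (2 * Real.pi) • (fun i => (n i : ℝ))
        = ∑ i, n i • ((2 * Real.pi) • (Pi.single i 1 : Fin m → ℝ)) := by
      ext j
      simp [Finset.sum_apply, Pi.single_apply, mul_comm]
    rw [this]
    refine AddSubgroup.sum_mem _ fun i _ => AddSubgroup.zsmul_mem _ ?_ _
    intro y
    rw [← update_eq]
    exact h y i
  unfold cpx
  rw [smul_add, hmem]

lemma coef_cpx {G : (Fin m → ℝ) → ℝ} (h : ∀ (x : Fin m → ℝ) (i : Fin m),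
      G (Function.update x i (x i + 2 * Real.pi)) = G x) :
    coef (cpx G) 0 = ((((2 * Real.pi) ^ m : ℝ)⁻¹ *
        (∫ x in Set.Icc (0 : Fin m → ℝ) (fun _ => 2 * Real.pi), G x) : ℝ) : ℂ) := by
  have hpi : 0 < 2 * Real.pi := by positivity
  rw [coef_eq (cpx_per h)]
  have h0 : ∀ x : Fin m → ℝ, ch (-0) x * cpx G x = ((G ((2 * Real.pi) • x) : ℝ) : ℂ) := by
    intro x
    simp [ch, cpx]
  simp_rw [h0]
  rw [integral_complex_ofReal, Measure.setIntegral_comp_smul_of_pos _ _ _ hpi]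
  congr 1
  rw [Module.finrank_fin_fun, smul_eq_mul]
  congr 1
  apply setIntegral_congr_set
  have h1 : (2 * Real.pi) • box m
      = Set.univ.pi (fun i : Fin m => Set.Ioc ((0 : Fin m → ℝ) i) ((fun _ => 2 * Real.pi) i)) := by
    ext x
    rw [Set.mem_smul_set_iff_inv_smul_mem₀ hpi.ne']
    simp only [box, Set.mem_ofPred_eq, Set.mem_univ_pi, Pi.smul_apply, smul_eq_mul, Set.mem_Ioc,
      Pi.zero_apply, zero_add]
    refine forall_congr' fun i => and_congr ?_ ?_
    · rw [inv_mul_eq_div, lt_div_iff₀ hpi, zero_mul]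
    · rw [inv_mul_eq_div, div_le_iff₀ hpi, one_mul]
  rw [h1]
  exact Measure.univ_pi_Ioc_ae_eq_Icc

lemma icc_vol (m : ℕ) : (volume : Measure (Fin m → ℝ)).real
    (Set.Icc (0 : Fin m → ℝ) (fun _ => 2 * Real.pi)) = (2 * Real.pi) ^ m := by
  have hpi : 0 < 2 * Real.pi := by positivity
  have h := Real.volume_Icc_pi_toReal (a := (0 : Fin m → ℝ)) (b := fun _ => 2 * Real.pi)
    (fun i => hpi.le)
  rw [Measure.real, h]
  simp

end
end Coh

/-- Smooth cohomological equation: under the Diophantine condition `DC(c₀,σ)`, every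
smooth torus function `F` can be written uniquely as `F(x) = [F] + G(x) − G(x+γ₀ω)` with
`G` a smooth torus function of zero mean. -/
theorem stmt_7 (m : ℕ) (hm : 1 ≤ m) (c₀ σ : ℝ) (hc₀ : 0 < c₀) (hσ : 0 < σ)
    (ω : Fin m → ℝ) (γ₀ : ℝ)
    (hDC : ∀ k : Fin m → ℤ, k ≠ 0 → ∀ j : ℤ,
      c₀ / (∑ i, (|k i| : ℝ)) ^ σ ≤
        |(∑ i, (k i : ℝ) * ω i) * γ₀ / (2 * Real.pi) - (j : ℝ)|)
    (F : (Fin m → ℝ) → ℝ) (hF : ContDiff ℝ (⊤ : ℕ∞) F)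
    (hFper : ∀ (x : Fin m → ℝ) (i : Fin m),
      F (Function.update x i (x i + 2 * Real.pi)) = F x) :
    ∃! G : (Fin m → ℝ) → ℝ,
      ContDiff ℝ (⊤ : ℕ∞) G ∧
      (∀ (x : Fin m → ℝ) (i : Fin m),
        G (Function.update x i (x i + 2 * Real.pi)) = G x) ∧
      ((2 * Real.pi) ^ m : ℝ)⁻¹ *
        (∫ x in Set.Icc (0 : Fin m → ℝ) (fun _ => 2 * Real.pi), G x) = 0 ∧
      ∀ x : Fin m → ℝ,
        F x = ((2 * Real.pi) ^ m : ℝ)⁻¹ *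
          (∫ y in Set.Icc (0 : Fin m → ℝ) (fun _ => 2 * Real.pi), F y) +
          G x - G (x + γ₀ • ω) := by
  have hpi : 0 < 2 * Real.pi := by positivity
  have hσ' := hσ
  set α : Fin m → ℝ := (2 * Real.pi)⁻¹ • (γ₀ • ω) with hαdef
  have h2α : (2 * Real.pi) • α = γ₀ • ω := by
    rw [hαdef, smul_smul, mul_inv_cancel₀ hpi.ne', one_smul]
  have hα : ∀ k : Fin m → ℤ, k ≠ 0 → c₀ / Coh.S k ^ σ ≤ ‖1 - Coh.ch k α‖ := by
    intro k hk
    unfold Coh.ch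
    apply Coh.dioph
    intro j
    have h := hDC k hk j
    have e : ∑ i, (k i : ℝ) * α i = (∑ i, (k i : ℝ) * ω i) * γ₀ / (2 * Real.pi) := by
      rw [Finset.sum_mul, Finset.sum_div]
      refine Finset.sum_congr rfl fun i _ => ?_
      simp only [hαdef, Pi.smul_apply, smul_eq_mul]
      field_simp
    rw [e]
    exact h
  have hne : ∀ k : Fin m → ℤ, k ≠ 0 → 1 - Coh.ch k α ≠ 0 := by
    intro k hk
    have h1 := Coh.one_le_S hk
    have h2 := hα k hk
    have : 0 < c₀ / Coh.S k ^ σ := by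
      have : 0 < Coh.S k := by linarith
      positivity
    rw [← norm_pos_iff]
    linarith
  have hint : ∀ G : (Fin m → ℝ) → ℝ, Continuous G →
      IntegrableOn G (Set.Icc (0 : Fin m → ℝ) (fun _ => 2 * Real.pi)) :=
    fun G hG => hG.continuousOn.integrableOn_compact isCompact_Icc
  obtain ⟨g, hgp, hgs, hg⟩ := Coh.exists_sol hm hc₀ α hα (Coh.cpx_per hFper) (Coh.cpx_smooth hF)
  rw [Coh.coef_cpx hFper] at hg
  set G₀ : (Fin m → ℝ) → ℝ := fun y => (g ((2 * Real.pi)⁻¹ • y)).re with hG₀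
  have hG₀s : ContDiff ℝ (⊤ : ℕ∞) G₀ :=
    Complex.reCLM.contDiff.comp (hgs.comp (contDiff_const_smul _))
  set M : ℝ := ((2 * Real.pi) ^ m : ℝ)⁻¹ *
    (∫ x in Set.Icc (0 : Fin m → ℝ) (fun _ => 2 * Real.pi), G₀ x) with hM
  refine existsUnique_of_exists_of_unique
    ⟨fun y => G₀ y - M, hG₀s.sub contDiff_const, ?_, ?_, ?_⟩ ?_
  · intro x i
    simp only [hG₀]
    rw [Coh.update_eq, smul_add, smul_smul, inv_mul_cancel₀ hpi.ne', one_smul]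
    have := hgp ((2 * Real.pi)⁻¹ • x) (Pi.single i 1)
    rw [show (fun j => (((Pi.single i 1 : Fin m → ℤ) j : ℤ) : ℝ)) = Pi.single i 1 by
      ext j
      by_cases hj : j = i
      · subst hj
        simp
      · simp [hj]] at this
    rw [this]
  · rw [integral_sub (hint _ hG₀s.continuous) (hint _ continuous_const), setIntegral_const,
      Coh.icc_vol, mul_sub, ← hM, smul_eq_mul, ← mul_assoc,
      inv_mul_cancel₀ (by positivity), one_mul, sub_self]
  · intro x
    have h := congrArg Complex.re (hg ((2 * Real.pi)⁻¹ • x))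
    simp only [Coh.cpx, smul_smul, mul_inv_cancel₀ hpi.ne', one_smul, Complex.ofReal_re,
      Complex.add_re, Complex.sub_re] at h
    have e : (2 * Real.pi)⁻¹ • (x + γ₀ • ω) = (2 * Real.pi)⁻¹ • x + α := by
      rw [smul_add]
    simp only [hG₀, e]
    rw [h]
    ring
  · rintro G H ⟨hGs, hGp, hGm, hGe⟩ ⟨hHs, hHp, hHm, hHe⟩
    have hDp : ∀ (x : Fin m → ℝ) (i : Fin m),
        (G - H) (Function.update x i (x i + 2 * Real.pi)) = (G - H) x := by
      intro x i
      simp only [Pi.sub_apply, hGp, hHp]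
    have hDc : Coh.coef (Coh.cpx (G - H)) 0 = 0 := by
      rw [Coh.coef_cpx hDp]
      simp only [Pi.sub_apply]
      rw [integral_sub (hint _ hGs.continuous) (hint _ hHs.continuous), mul_sub, hGm, hHm]
      simp
    have hz := Coh.unique_sol hne (Coh.cpx_per hDp) (Coh.cpx_smooth (hGs.sub hHs)).continuous hDc
      (fun x => by
        unfold Coh.cpx
        rw [smul_add, h2α]
        have h1 := hGe ((2 * Real.pi) • x)
        have h2 := hHe ((2 * Real.pi) • x)
        simp only [Pi.sub_apply]
        congr 1
        linarith)
    ext y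
    have h := hz ((2 * Real.pi)⁻¹ • y)
    unfold Coh.cpx at h
    rw [smul_smul, mul_inv_cancel₀ hpi.ne', one_smul, Complex.ofReal_eq_zero, Pi.sub_apply] at h
    linarith
end

section
/- Let γ₀ ∈ ℝ and let M : ℝ² → ℝ², M(θ,r) = (θ + γ₀ + f(θ,r), h(θ,r)), be continuously differentiable with f(θ,0) = 0 and h(θ,0) = 0 for all θ ∈ ℝ. Let G(θ,r) = (−θ, r) and assume M(G(M(θ,r))) = G(θ,r) for all (θ,r). Define φ̃₁(θ) = ∂h/∂r (θ, 0). Then φ̃₁(θ) · φ̃₁(−θ − γ₀) = 1 for all θ ∈ ℝ. In particular φ̃₁ never vanishes. -/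
/-- If `M(θ,r) = (θ + γ₀ + f(θ,r), h(θ,r))` is a continuously differentiable map with
`f(θ,0) = 0`, `h(θ,0) = 0`, reversible with respect to `G(θ,r) = (−θ,r)`, then the
first-order coefficient `φ̃₁(θ) = ∂h/∂r(θ,0)` satisfies `φ̃₁(θ) φ̃₁(−θ−γ₀) = 1`;
in particular it never vanishes. -/
theorem stmt_10 (γ₀ : ℝ) (f h : ℝ × ℝ → ℝ)
    (hf : ContDiff ℝ 1 f) (hh : ContDiff ℝ 1 h)
    (hf0 : ∀ θ : ℝ, f (θ, 0) = 0) (hh0 : ∀ θ : ℝ, h (θ, 0) = 0)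
    (M : ℝ × ℝ → ℝ × ℝ)
    (hM : ∀ p : ℝ × ℝ, M p = (p.1 + γ₀ + f p, h p))
    (G : ℝ × ℝ → ℝ × ℝ)
    (hG : ∀ p : ℝ × ℝ, G p = (-p.1, p.2))
    (hrev : ∀ p : ℝ × ℝ, M (G (M p)) = G p)
    (φ₁ : ℝ → ℝ)
    (hφ₁ : ∀ θ : ℝ, φ₁ θ = deriv (fun r : ℝ => h (θ, r)) 0) :
    (∀ θ : ℝ, φ₁ θ * φ₁ (-θ - γ₀) = 1) ∧ ∀ θ : ℝ, φ₁ θ ≠ 0 := by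
  have hhd : ∀ p, HasFDerivAt h (fderiv ℝ h p) p := fun p =>
    (hh.differentiable (by norm_num) p).hasFDerivAt
  have hfd : ∀ p, HasFDerivAt f (fderiv ℝ f p) p := fun p =>
    (hf.differentiable (by norm_num) p).hasFDerivAt
  have hcurve : ∀ θ : ℝ, HasDerivAt (fun r : ℝ => ((θ, r) : ℝ × ℝ)) (0, 1) 0 := fun θ =>
    (hasDerivAt_const (0 : ℝ) θ).prodMk (hasDerivAt_id (0 : ℝ))
  have hr : ∀ θ : ℝ, HasDerivAt (fun r : ℝ => h (θ, r)) (fderiv ℝ h (θ, 0) (0, 1)) 0 :=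
    fun θ => (hhd (θ, 0)).comp_hasDerivAt (0 : ℝ) (hcurve θ)
  have fr : ∀ θ : ℝ, HasDerivAt (fun r : ℝ => f (θ, r)) (fderiv ℝ f (θ, 0) (0, 1)) 0 :=
    fun θ => (hfd (θ, 0)).comp_hasDerivAt (0 : ℝ) (hcurve θ)
  have hφ : ∀ θ : ℝ, φ₁ θ = fderiv ℝ h (θ, 0) (0, 1) := fun θ => by
    rw [hφ₁, (hr θ).deriv]
  have hθ : ∀ θ : ℝ, fderiv ℝ h (θ, 0) (1, 0) = 0 := by
    intro θ
    have h1 : HasDerivAt (fun t : ℝ => ((t, 0) : ℝ × ℝ)) (1, 0) θ :=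
      (hasDerivAt_id θ).prodMk (hasDerivAt_const θ (0 : ℝ))
    have h2 : HasDerivAt (fun t : ℝ => h (t, 0)) (fderiv ℝ h (θ, 0) (1, 0)) θ :=
      (hhd (θ, 0)).comp_hasDerivAt θ h1
    have h3 : (fun t : ℝ => h (t, 0)) = fun _ => 0 := funext hh0
    rw [h3] at h2
    exact h2.unique (hasDerivAt_const θ 0)
  have key : ∀ θ : ℝ, φ₁ θ * φ₁ (-θ - γ₀) = 1 := by
    intro θ
    have hc := (((fr θ).const_add (θ + γ₀)).neg).prodMk (hr θ)
    have hp : ((-(θ + γ₀ + f (θ, 0)), h (θ, 0)) : ℝ × ℝ) = (-θ - γ₀, 0) := by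
      rw [hf0, hh0]; congr 1; ring
    have hd := hhd (-θ - γ₀, 0)
    rw [← hp] at hd
    have h2 := hd.comp_hasDerivAt (0 : ℝ) hc
    rw [hp] at h2
    have h3 : HasDerivAt (fun r : ℝ => r) (fderiv ℝ h (-θ - γ₀, 0)
        (-(fderiv ℝ f (θ, 0) (0, 1)), fderiv ℝ h (θ, 0) (0, 1))) 0 := by
      refine h2.congr_of_eventuallyEq (Filter.Eventually.of_forall fun r => ?_)
      have := congrArg Prod.snd (hrev (θ, r))
      simp only [hM, hG] at this
      exact this.symm
    have h4 := h3.unique (hasDerivAt_id' (0 : ℝ))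
    have h5 : ∀ a b : ℝ, ((a, b) : ℝ × ℝ) = a • (1, 0) + b • (0, 1) := by
      intro a b; simp
    rw [h5 (-(fderiv ℝ f (θ, 0) (0, 1))), map_add, map_smul, map_smul, hθ, ← hφ, ← hφ] at h4
    simpa using h4
  exact ⟨key, fun θ h0 => by simpa [h0] using key θ⟩
end

section
/- Let g : ℝ → ℝ be real analytic such that the finite limits g(+∞) = lim_{x→+∞} g(x) and g(−∞) = lim_{x→−∞} g(x) exist and lim_{|x|→∞} x⁴ g⁽⁴⁾(x) = 0. For λ > 0 define J₂(λ) = (1/(2πλ)) ∫₀^{2π} g(λ cos t) cos t dt. Then for each integer k with 0 ≤ k ≤ 4: lim_{λ→+∞} λ^{k+1} J₂^{(k)}(λ) = (−1)^k k! (1/π) (g(+∞) − g(−∞)). -/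
open Filter intervalIntegral

lemma aux_taylor (g : ℝ → ℝ) (hg : ContDiff ℝ 4 g) (c : ℝ) (hc : 0 < c) (x : ℝ) (hx : 0 < x) :
    ∃ y, x < y ∧ g (x + c * x) - g x - (c * (x * iteratedDeriv 1 g x)
      + c ^ 2 * (x ^ 2 * iteratedDeriv 2 g x / 2) + c ^ 3 * (x ^ 3 * iteratedDeriv 3 g x / 6))
      = c ^ 4 / 24 * (x ^ 4 * iteratedDeriv 4 g y) := by
  have hcx : 0 < c * x := mul_pos hc hx
  have hlt : x < x + c * x := by linarith
  obtain ⟨y, hy, h⟩ := taylor_mean_remainder_lagrange_iteratedDeriv (n := 3) (f := g) hlt.ne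
    (by norm_num; exact hg.contDiffOn)
  rw [Set.uIoo_of_lt hlt] at hy
  refine ⟨y, hy.1, ?_⟩
  have hu := uniqueDiffOn_uIcc hlt.ne
  have key : ∀ k : ℕ, k ≤ 4 →
      iteratedDerivWithin k g (Set.uIcc x (x + c * x)) x = iteratedDeriv k g x := fun k hk =>
    iteratedDerivWithin_eq_iteratedDeriv hu
      ((hg.of_le (by exact_mod_cast hk)).contDiffAt) Set.left_mem_uIcc
  rw [taylor_within_apply] at h
  simp only [Finset.sum_range_succ, Finset.sum_range_zero] at h
  rw [key 0 (by norm_num), key 1 (by norm_num), key 2 (by norm_num), key 3 (by norm_num)] at h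
  simp only [add_sub_cancel_left, smul_eq_mul, Nat.factorial, iteratedDeriv_zero] at h
  norm_num at h
  norm_num
  linear_combination h

lemma aux_err (g : ℝ → ℝ) (hg : ContDiff ℝ 4 g) (p : ℝ) (hp : Tendsto g atTop (nhds p))
    (h4 : Tendsto (fun x : ℝ => x ^ 4 * iteratedDeriv 4 g x) atTop (nhds 0))
    (c : ℝ) (hc : 0 < c) :
    Tendsto (fun x => c * (x * iteratedDeriv 1 g x)
      + c ^ 2 * (x ^ 2 * iteratedDeriv 2 g x / 2) + c ^ 3 * (x ^ 3 * iteratedDeriv 3 g x / 6))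
      atTop (nhds 0) := by
  have h1 : Tendsto (fun x => g (x + c * x) - g x) atTop (nhds 0) := by
    have : Tendsto (fun x => x + c * x) atTop atTop :=
      tendsto_id.atTop_add_atTop (tendsto_id.const_mul_atTop hc)
    simpa using (hp.comp this).sub hp
  have h2 : Tendsto (fun x => (c * (x * iteratedDeriv 1 g x)
      + c ^ 2 * (x ^ 2 * iteratedDeriv 2 g x / 2) + c ^ 3 * (x ^ 3 * iteratedDeriv 3 g x / 6))
      - (g (x + c * x) - g x)) atTop (nhds 0) := by
    rw [Metric.tendsto_atTop] at h4 ⊢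
    intro ε hε
    have hc4 : 0 < c ^ 4 / 24 := by positivity
    obtain ⟨N, hN⟩ := h4 (ε / (c ^ 4 / 24)) (by positivity)
    refine ⟨max N 1, fun x hx => ?_⟩
    have hx1 : 1 ≤ x := le_trans (le_max_right _ _) hx
    have hxN : N ≤ x := le_trans (le_max_left _ _) hx
    obtain ⟨y, hy, h⟩ := aux_taylor g hg c hc x (by linarith)
    have hb := hN y (by linarith)
    rw [Real.dist_eq, sub_zero] at hb ⊢
    rw [abs_sub_comm, h, abs_mul, abs_of_pos hc4]
    have : |x ^ 4 * iteratedDeriv 4 g y| ≤ |y ^ 4 * iteratedDeriv 4 g y| := by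
      rw [abs_mul, abs_mul, abs_pow, abs_pow, abs_of_pos (by linarith : 0 < x),
        abs_of_pos (by linarith : 0 < y)]
      gcongr
    rw [lt_div_iff₀ hc4] at hb
    nlinarith
  simpa using h2.add h1

lemma aux_top (g : ℝ → ℝ) (hg : ContDiff ℝ 4 g) (p : ℝ) (hp : Tendsto g atTop (nhds p))
    (h4 : Tendsto (fun x : ℝ => x ^ 4 * iteratedDeriv 4 g x) atTop (nhds 0)) :
    ∀ k : ℕ, 1 ≤ k → k ≤ 4 →
      Tendsto (fun x : ℝ => x ^ k * iteratedDeriv k g x) atTop (nhds 0) := by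
  have e1 := aux_err g hg p hp h4 1 (by norm_num)
  have e2 := aux_err g hg p hp h4 2 (by norm_num)
  have e3 := aux_err g hg p hp h4 3 (by norm_num)
  intro k hk hk4
  interval_cases k
  · have := ((e1.const_mul 3).add (e2.const_mul (-3/2))).add (e3.const_mul (1/3))
    simp only [mul_zero, add_zero] at this
    exact this.congr fun x => by ring
  · have := ((e1.const_mul (-5)).add (e2.const_mul 4)).add (e3.const_mul (-1))
    simp only [mul_zero, add_zero] at this
    exact this.congr fun x => by ring
  · have := ((e1.const_mul 3).add (e2.const_mul (-3))).add (e3.const_mul 1)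
    simp only [mul_zero, add_zero] at this
    exact this.congr fun x => by ring
  · exact h4

lemma aux_neg (g : ℝ → ℝ) (k : ℕ) (x : ℝ) :
    x ^ k * iteratedDeriv k (fun x => g (-x)) x = (-x) ^ k * iteratedDeriv k g (-x) := by
  rw [iteratedDeriv_comp_neg, neg_pow x, smul_eq_mul]; ring

lemma aux_bot (g : ℝ → ℝ) (hg : ContDiff ℝ 4 g) (p : ℝ) (hp : Tendsto g atBot (nhds p))
    (h4 : Tendsto (fun x : ℝ => x ^ 4 * iteratedDeriv 4 g x) atBot (nhds 0)) :
    ∀ k : ℕ, 1 ≤ k → k ≤ 4 →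
      Tendsto (fun x : ℝ => x ^ k * iteratedDeriv k g x) atBot (nhds 0) := by
  intro k hk hk4
  have := aux_top (fun x => g (-x)) (hg.comp contDiff_neg) p (hp.comp tendsto_neg_atTop_atBot)
    ((h4.comp tendsto_neg_atTop_atBot).congr fun x => (aux_neg g 4 x).symm) k hk hk4
  refine (this.comp tendsto_neg_atBot_atTop).congr fun x => ?_
  simp only [Function.comp]
  rw [aux_neg, neg_neg]

lemma aux_bdd (h : ℝ → ℝ) (hc : Continuous h) (p m : ℝ) (hp : Tendsto h atTop (nhds p))
    (hm : Tendsto h atBot (nhds m)) : ∃ C, ∀ x, |h x| ≤ C := by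
  obtain ⟨A, hA⟩ := eventually_atTop.1 (hp.abs.eventually (ge_mem_nhds (lt_add_one |p|)))
  obtain ⟨B, hB⟩ := eventually_atBot.1 (hm.abs.eventually (ge_mem_nhds (lt_add_one |m|)))
  obtain ⟨C, hC⟩ := (isCompact_Icc (a := B) (b := A)).exists_bound_of_continuousOn hc.continuousOn
  refine ⟨max C (max (|p| + 1) (|m| + 1)), fun x => ?_⟩
  rcases le_total A x with h1 | h1
  · exact (hA x h1).trans (by simp)
  rcases le_total x B with h2 | h2
  · exact (hB x h2).trans (by simp)
  · exact (hC x ⟨h2, h1⟩).trans (by simp)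

lemma aux_abs_cos : ∫ t in (0 : ℝ)..(2 * Real.pi), |Real.cos t| = 4 := by
  have hpi := Real.pi_pos
  have hi : ∀ a b : ℝ, IntervalIntegrable (fun t => |Real.cos t|) MeasureTheory.volume a b :=
    fun a b => (Real.continuous_cos.abs).intervalIntegrable a b
  rw [← integral_add_adjacent_intervals (hi 0 (Real.pi / 2)) (hi _ _),
    ← integral_add_adjacent_intervals (hi (Real.pi / 2) (3 * Real.pi / 2)) (hi _ _)]
  have h1 : ∫ t in (0 : ℝ)..(Real.pi / 2), |Real.cos t| = 1 := by
    rw [integral_congr (g := Real.cos)]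
    · simp
    · intro t ht
      rw [Set.uIcc_of_le (by linarith)] at ht
      exact abs_of_nonneg (Real.cos_nonneg_of_mem_Icc ⟨by linarith [ht.1], ht.2⟩)
  have hs : Real.sin (3 * Real.pi / 2) = -1 := by
    rw [show 3 * Real.pi / 2 = Real.pi / 2 + Real.pi by ring, Real.sin_add_pi]; simp
  have h2 : ∫ t in (Real.pi / 2)..(3 * Real.pi / 2), |Real.cos t| = 2 := by
    rw [integral_congr (g := fun t => - Real.cos t)]
    · simp [hs]; norm_num
    · intro t ht
      rw [Set.uIcc_of_le (by linarith)] at ht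
      exact abs_of_nonpos (Real.cos_nonpos_of_pi_div_two_le_of_le ht.1 (by linarith [ht.2]))
  have h3 : ∫ t in (3 * Real.pi / 2)..(2 * Real.pi), |Real.cos t| = 1 := by
    rw [integral_congr (g := Real.cos)]
    · simp [hs]
    · intro t ht
      rw [Set.uIcc_of_le (by linarith)] at ht
      refine abs_of_nonneg ?_
      rw [← Real.cos_sub_two_pi]
      exact Real.cos_nonneg_of_mem_Icc ⟨by linarith [ht.1], by linarith [ht.2]⟩
  rw [h1, h2, h3]; norm_num

lemma aux_lim (h : ℝ → ℝ) (hc : Continuous h) (p m : ℝ) (hp : Tendsto h atTop (nhds p))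
    (hm : Tendsto h atBot (nhds m)) :
    Tendsto (fun l : ℝ => ∫ t in (0 : ℝ)..(2 * Real.pi), h (l * Real.cos t) * Real.cos t) atTop
      (nhds (2 * (p - m))) := by
  obtain ⟨C, hC⟩ := aux_bdd h hc p m hp hm
  have hval : ∫ t in (0 : ℝ)..(2 * Real.pi), ((p + m) / 2 * Real.cos t + (p - m) / 2 * |Real.cos t|)
      = 2 * (p - m) := by
    rw [integral_add, integral_const_mul, integral_const_mul, aux_abs_cos]
    · simp; ring
    · exact Continuous.intervalIntegrable (by fun_prop) _ _
    · exact Continuous.intervalIntegrable (by fun_prop) _ _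
  rw [← hval]
  refine tendsto_integral_filter_of_dominated_convergence (fun _ => C) ?_ ?_ ?_ ?_
  · exact Eventually.of_forall fun l => Continuous.aestronglyMeasurable (by fun_prop)
  · refine Eventually.of_forall fun l => Eventually.of_forall fun t _ => ?_
    rw [norm_mul, Real.norm_eq_abs, Real.norm_eq_abs]
    have := hC (l * Real.cos t)
    have h2 := Real.abs_cos_le_one t
    nlinarith [abs_nonneg (h (l * Real.cos t)), abs_nonneg (Real.cos t)]
  · exact intervalIntegrable_const
  · refine Eventually.of_forall fun t _ => ?_
    rcases lt_trichotomy (Real.cos t) 0 with ht | ht | ht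
    · have := (hm.comp (tendsto_id.atTop_mul_const_of_neg ht)).mul_const (Real.cos t)
      rw [abs_of_neg ht]
      have e : ∀ a b : ℝ, a = b → Tendsto (fun n => h (n * Real.cos t) * Real.cos t) atTop (nhds b)
          → Tendsto (fun n => h (n * Real.cos t) * Real.cos t) atTop (nhds a) := by
        rintro a b rfl h
        exact h
      exact e _ _ (by ring) this
    · simp [ht]
    · have := (hp.comp (tendsto_id.atTop_mul_const ht)).mul_const (Real.cos t)
      rw [abs_of_pos ht]
      have e : ∀ a b : ℝ, a = b → Tendsto (fun n => h (n * Real.cos t) * Real.cos t) atTop (nhds b)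
          → Tendsto (fun n => h (n * Real.cos t) * Real.cos t) atTop (nhds a) := by
        rintro a b rfl h
        exact h
      exact e _ _ (by ring) this

lemma aux_deriv (f f' : ℝ → ℝ) (hf : ∀ x, HasDerivAt f (f' x) x) (hf' : Continuous f') (m : ℕ)
    (l : ℝ) :
    HasDerivAt (fun l : ℝ => ∫ t in (0 : ℝ)..(2 * Real.pi), f (l * Real.cos t) * Real.cos t ^ m)
      (∫ t in (0 : ℝ)..(2 * Real.pi), f' (l * Real.cos t) * Real.cos t ^ (m + 1)) l := by
  have hfc : Continuous f := continuous_iff_continuousAt.2 fun x => (hf x).continuousAt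
  obtain ⟨C, hC⟩ := (isCompact_Icc (a := -(|l| + 1)) (b := |l| + 1)).exists_bound_of_continuousOn
    hf'.continuousOn
  refine (intervalIntegral.hasDerivAt_integral_of_dominated_loc_of_deriv_le (bound := fun _ => C)
    (F := fun l t => f (l * Real.cos t) * Real.cos t ^ m)
    (F' := fun l t => f' (l * Real.cos t) * Real.cos t ^ (m + 1))
    (Metric.ball_mem_nhds l one_pos) ?_ ?_ ?_ ?_ ?_ ?_).2
  · exact Eventually.of_forall fun l => Continuous.aestronglyMeasurable (by fun_prop)
  · exact Continuous.intervalIntegrable (by fun_prop) _ _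
  · exact Continuous.aestronglyMeasurable (by fun_prop)
  · refine Eventually.of_forall fun t _ x hx => ?_
    have h2 := Real.abs_cos_le_one t
    have hx1 : |x| ≤ |l| + 1 := by
      rw [Metric.mem_ball, Real.dist_eq] at hx
      have := abs_sub_abs_le_abs_sub x l
      linarith
    have h3 : |x * Real.cos t| ≤ |l| + 1 := by
      rw [abs_mul]
      nlinarith [abs_nonneg x, abs_nonneg (Real.cos t)]
    have h4 := hC (x * Real.cos t) (abs_le.1 h3)
    rw [norm_mul, norm_pow, Real.norm_eq_abs (Real.cos t)]
    have h5 : |Real.cos t| ^ (m + 1) ≤ 1 := pow_le_one₀ (abs_nonneg _) h2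
    nlinarith [norm_nonneg (f' (x * Real.cos t)), pow_nonneg (abs_nonneg (Real.cos t)) (m + 1)]
  · exact intervalIntegrable_const
  · refine Eventually.of_forall fun t _ x _ => ?_
    have h1 : HasDerivAt (fun x => x * Real.cos t) (Real.cos t) x := by
      simpa using (hasDerivAt_id x).mul_const (Real.cos t)
    have := ((hf (x * Real.cos t)).comp x h1).mul_const (Real.cos t ^ m)
    refine this.congr_deriv ?_
    ring

lemma aux_hasDeriv (g : ℝ → ℝ) (hg : ContDiff ℝ (⊤ : ℕ∞) g) (k : ℕ) (x : ℝ) :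
    HasDerivAt (iteratedDeriv k g) (iteratedDeriv (k + 1) g x) x := by
  rw [iteratedDeriv_succ]
  exact ((hg.differentiable_iteratedDeriv k (by exact_mod_cast ENat.natCast_lt_top k)) x).hasDerivAt

lemma aux_cont (g : ℝ → ℝ) (hg : ContDiff ℝ (⊤ : ℕ∞) g) (k : ℕ) :
    Continuous (iteratedDeriv k g) :=
  continuous_iff_continuousAt.2 fun x => (aux_hasDeriv g hg k x).continuousAt

lemma aux_iter (g : ℝ → ℝ) (hg : ContDiff ℝ (⊤ : ℕ∞) g) (k : ℕ) :
    iteratedDeriv k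
      (fun l : ℝ => ∫ t in (0 : ℝ)..(2 * Real.pi), g (l * Real.cos t) * Real.cos t) =
    fun l => ∫ t in (0 : ℝ)..(2 * Real.pi),
      iteratedDeriv k g (l * Real.cos t) * Real.cos t ^ (k + 1) := by
  induction k with
  | zero => simp
  | succ k ih =>
    rw [iteratedDeriv_succ, ih]
    funext l
    exact (aux_deriv _ _ (aux_hasDeriv g hg k) (aux_cont g hg (k + 1)) (k + 1) l).deriv

lemma aux_smooth (g : ℝ → ℝ) (hg : ContDiff ℝ (⊤ : ℕ∞) g) :
    ContDiff ℝ (⊤ : ℕ∞)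
      (fun l : ℝ => ∫ t in (0 : ℝ)..(2 * Real.pi), g (l * Real.cos t) * Real.cos t) := by
  refine contDiff_of_differentiable_iteratedDeriv fun k _ => ?_
  rw [aux_iter g hg]
  exact fun l => (aux_deriv _ _ (aux_hasDeriv g hg k) (aux_cont g hg (k + 1))
    (k + 1) l).differentiableAt

/-- Averaging limit: if `g` is real analytic with finite limits `g(±∞)` at `±∞` and
`x⁴g⁽⁴⁾(x) → 0` as `|x| → ∞`, and `J₂(λ) = (1/(2πλ)) ∫₀^{2π} g(λ cos t) cos t dt`, then
for `0 ≤ k ≤ 4`, `λ^{k+1} J₂⁽ᵏ⁾(λ) → (−1)^k k! (1/π)(g(+∞) − g(−∞))` as `λ → +∞`. -/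
theorem stmt_16 (g : ℝ → ℝ) (hganal : ∀ x : ℝ, AnalyticAt ℝ g x)
    (gp gm : ℝ)
    (hgp : Tendsto g atTop (nhds gp)) (hgm : Tendsto g atBot (nhds gm))
    (hg4top : Tendsto (fun x : ℝ => x ^ 4 * iteratedDeriv 4 g x) atTop (nhds 0))
    (hg4bot : Tendsto (fun x : ℝ => x ^ 4 * iteratedDeriv 4 g x) atBot (nhds 0))
    (J₂ : ℝ → ℝ)
    (hJ₂ : ∀ l : ℝ, J₂ l =
      (1 / (2 * Real.pi * l)) * ∫ t in (0 : ℝ)..(2 * Real.pi), g (l * Real.cos t) * Real.cos t) :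
    ∀ k : ℕ, k ≤ 4 →
      Tendsto (fun l : ℝ => l ^ (k + 1) * iteratedDeriv k J₂ l) atTop
        (nhds ((-1 : ℝ) ^ k * (Nat.factorial k) * (1 / Real.pi) * (gp - gm))) := by
  intro k hk
  have hg : ContDiff ℝ (⊤ : ℕ∞) g := AnalyticOnNhd.contDiff (fun x _ => hganal x)
  have hg4 : ContDiff ℝ 4 g := AnalyticOnNhd.contDiff (fun x _ => hganal x)
  set I : ℝ → ℝ :=
    fun l : ℝ => ∫ t in (0 : ℝ)..(2 * Real.pi), g (l * Real.cos t) * Real.cos t with hI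
  have hIs : ContDiff ℝ (⊤ : ℕ∞) I := aux_smooth g hg
  have hIk : ∀ (i : ℕ) (l : ℝ), l ^ i * iteratedDeriv i I l =
      ∫ t in (0 : ℝ)..(2 * Real.pi),
        ((l * Real.cos t) ^ i * iteratedDeriv i g (l * Real.cos t)) * Real.cos t := by
    intro i l
    rw [hI, aux_iter g hg, ← integral_const_mul]
    refine integral_congr fun t _ => ?_
    ring
  have hI0 : Tendsto I atTop (nhds (2 * (gp - gm))) := aux_lim g hg.continuous gp gm hgp hgm
  have hIlim : ∀ i : ℕ, 1 ≤ i → i ≤ 4 →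
      Tendsto (fun l => l ^ i * iteratedDeriv i I l) atTop (nhds 0) := by
    intro i h1 h4
    refine Tendsto.congr (fun l => (hIk i l).symm) ?_
    have := aux_lim (fun x => x ^ i * iteratedDeriv i g x)
      ((continuous_pow i).mul (aux_cont g hg i)) 0 0
      (aux_top g hg4 gp hgp hg4top i h1 h4) (aux_bot g hg4 gm hgm hg4bot i h1 h4)
    simpa using this
  have hJ : J₂ = fun l => (1 / (2 * Real.pi)) * (I * (Inv.inv : ℝ → ℝ)) l := by
    funext l
    rw [hJ₂ l, Pi.mul_apply, one_div_mul_eq_div, hI]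
    simp only [one_div, mul_inv, div_eq_mul_inv]
    ring
  have hform : ∀ l : ℝ, 0 < l → l ^ (k + 1) * iteratedDeriv k J₂ l =
      (1 / (2 * Real.pi)) * ∑ i ∈ Finset.range (k + 1),
        (k.choose i * ((-1) ^ (k - i) * (k - i).factorial)) * (l ^ i * iteratedDeriv i I l) := by
    intro l hl
    rw [hJ, iteratedDeriv_const_mul_field, iteratedDeriv_mul
      ((hIs.of_le (by exact_mod_cast le_top)).contDiffAt) (contDiffAt_inv ℝ hl.ne'),
      mul_left_comm, Finset.mul_sum]
    congr 1
    refine Finset.sum_congr rfl fun i hi => ?_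
    have hik : i ≤ k := by simpa [Nat.lt_succ_iff] using hi
    rw [iteratedDeriv_eq_iterate (f := Inv.inv), iter_deriv_inv]
    obtain ⟨j, rfl⟩ := Nat.exists_eq_add_of_le hik
    have : l ^ (i + j + 1) * l ^ (-1 - ((i + j - i : ℕ) : ℤ)) = l ^ i := by
      rw [← zpow_natCast, ← zpow_natCast, ← zpow_add₀ hl.ne']
      congr 1
      rw [Nat.add_sub_cancel_left]
      push_cast
      ring
    linear_combination (((i + j).choose i : ℝ) * iteratedDeriv i I l
      * ((-1) ^ (i + j - i) * ((i + j - i).factorial : ℝ))) * this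
  have hev : (fun l : ℝ => (1 / (2 * Real.pi)) * ∑ i ∈ Finset.range (k + 1),
        (k.choose i * ((-1) ^ (k - i) * (k - i).factorial)) * (l ^ i * iteratedDeriv i I l))
      =ᶠ[atTop] (fun l : ℝ => l ^ (k + 1) * iteratedDeriv k J₂ l) := by
    filter_upwards [eventually_gt_atTop 0] with l hl
    exact (hform l hl).symm
  refine Tendsto.congr' hev ?_
  have hsum : Tendsto (fun l : ℝ => ∑ i ∈ Finset.range (k + 1),
        ((k.choose i : ℝ) * ((-1) ^ (k - i) * (k - i).factorial)) * (l ^ i * iteratedDeriv i I l))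
      atTop (nhds (∑ i ∈ Finset.range (k + 1),
        ((k.choose i : ℝ) * ((-1) ^ (k - i) * (k - i).factorial)) *
          (if i = 0 then 2 * (gp - gm) else 0))) := by
    refine tendsto_finsetSum _ fun i hi => Tendsto.const_mul _ ?_
    have hik : i ≤ k := by simpa [Nat.lt_succ_iff] using hi
    by_cases h0 : i = 0
    · subst h0
      simpa using hI0
    · simpa [h0] using hIlim i (Nat.one_le_iff_ne_zero.2 h0) (hik.trans hk)
  have := hsum.const_mul (1 / (2 * Real.pi))
  convert this using 2
  simp
  field_simp
end
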